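/- (Strict boundary derivative inequality for the torsion function.) Let s ∈ (0, r1−r0) and let y_s be the torsion function of Ω(s). Then for every x = (x1,…,xN) ∈ ∂B(s e1, r0) with x1 > s, ⟨∇y_s(x'), n(x')⟩ < ⟨∇y_s(x), n(x)⟩ < 0, where x' = (2s−x1, x2,…,xN) and n(z) = (s e1 − z)/r0 denotes the unit normal on ∂B(s e1, r0) pointing out of Ω(s). -/

import Mathlib

open MeasureTheory RealInnerProductSpace Metric Set

noncomputable section

/-- Smooth test functions compactly supported in `U` (the class `C_c^∞(U)`). -/
def IsTestFun {N : ℕ} (U : Set (EuclideanSpace ℝ (Fin N)))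
    (φ : EuclideanSpace ℝ (Fin N) → ℝ) : Prop :=
  ContDiff ℝ (⊤ : ℕ∞) φ ∧ HasCompactSupport φ ∧ tsupport φ ⊆ U

/-- `u` is a weak solution of `-Δ_p u = h` in `U`:
`∫_U |∇u|^{p-2} ⟨∇u, ∇φ⟩ = ∫_U h φ` for all test functions `φ`. -/
def IsWeakSolution (p : ℝ) {N : ℕ} (U : Set (EuclideanSpace ℝ (Fin N)))
    (u h : EuclideanSpace ℝ (Fin N) → ℝ) : Prop :=
  ∀ φ : EuclideanSpace ℝ (Fin N) → ℝ, IsTestFun U φ →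
    (∫ x in U, ‖gradient u x‖ ^ (p - 2) * ⟪gradient u x, gradient φ x⟫)
      = ∫ x in U, h x * φ x

/-- The `p`-torsional rigidity of `U`:
`E(U) = (p/(p-1)) ⬝ sup { ∫_U φ - (1/p) ∫_U |∇φ|^p : φ ∈ C_c^∞(U) }`. -/
def pTorsionalRigidity (p : ℝ) {N : ℕ} (U : Set (EuclideanSpace ℝ (Fin N))) : ℝ :=
  (p / (p - 1)) *
    sSup { r : ℝ | ∃ φ, IsTestFun U φ ∧
      r = (∫ x in U, φ x) - (1 / p) * ∫ x in U, ‖gradient φ x‖ ^ p }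

/-- The first Dirichlet eigenvalue of the `p`-Laplacian on `U`:
`λ₁(U) = inf { (∫_U |∇φ|^p)/(∫_U |φ|^p) : φ ∈ C_c^∞(U), φ ≢ 0 }`. -/
def pLambda1 (p : ℝ) {N : ℕ} (U : Set (EuclideanSpace ℝ (Fin N))) : ℝ :=
  sInf { r : ℝ | ∃ φ, IsTestFun U φ ∧ φ ≠ 0 ∧
    r = (∫ x in U, ‖gradient φ x‖ ^ p) / (∫ x in U, |φ x| ^ p) }

/-- `f` is `C^1` on the closure of `U` (i.e. `C^1` on an open neighbourhood of it). -/
def C1OnClosure {N : ℕ} (U : Set (EuclideanSpace ℝ (Fin N)))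
    (f : EuclideanSpace ℝ (Fin N) → ℝ) : Prop :=
  ∃ W, IsOpen W ∧ closure U ⊆ W ∧ ContDiffOn ℝ 1 f W

/-- `Ω` has a smooth boundary: it is the sublevel set of a smooth function whose
differential does not vanish on the boundary. -/
def HasSmoothBoundary {N : ℕ} (Ω : Set (EuclideanSpace ℝ (Fin N))) : Prop :=
  ∃ f : EuclideanSpace ℝ (Fin N) → ℝ, ContDiff ℝ (⊤ : ℕ∞) f ∧ Ω = f ⁻¹' Set.Iio 0 ∧
    ∀ x ∈ frontier Ω, fderiv ℝ f x ≠ 0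

/-- The index of the first coordinate. -/
def firstIdx (N : ℕ) (hN : 2 ≤ N) : Fin N := ⟨0, by omega⟩

/-- The first standard basis vector `e₁`. -/
def e1v {N : ℕ} (hN : 2 ≤ N) : EuclideanSpace ℝ (Fin N) :=
  EuclideanSpace.single (firstIdx N hN) 1

/-- The domain `Ω(s) = B(0,r1) \ closure B(s e₁, r0)`. -/
def annulus {N : ℕ} (hN : 2 ≤ N) (r0 r1 s : ℝ) : Set (EuclideanSpace ℝ (Fin N)) :=
  Metric.ball (0 : EuclideanSpace ℝ (Fin N)) r1 \ closure (Metric.ball (s • e1v hN) r0)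

/-- Reflection across the hyperplane `{x₁ = s}`: `x ↦ (2s - x₁, x₂, …, x_N)`. -/
def reflectH {N : ℕ} (hN : 2 ≤ N) (s : ℝ) (x : EuclideanSpace ℝ (Fin N)) :
    EuclideanSpace ℝ (Fin N) :=
  x + (2 * (s - x (firstIdx N hN))) • e1v hN

/-- The divergence of a vector field, as the trace of its Jacobian. -/
def divergence {N : ℕ} (V : EuclideanSpace ℝ (Fin N) → EuclideanSpace ℝ (Fin N))
    (x : EuclideanSpace ℝ (Fin N)) : ℝ :=
  LinearMap.trace ℝ _ (fderiv ℝ V x : EuclideanSpace ℝ (Fin N) →ₗ[ℝ] EuclideanSpace ℝ (Fin N))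

/-- The classical `p`-Laplacian `Δ_p b = div(|∇b|^{p-2} ∇b)` at a point. -/
def pLapAt (p : ℝ) {N : ℕ} (b : EuclideanSpace ℝ (Fin N) → ℝ)
    (x : EuclideanSpace ℝ (Fin N)) : ℝ :=
  divergence (fun z => ‖gradient b z‖ ^ (p - 2) • gradient b z) x

/-- The torsion function of `U`: `C^1` up to the boundary, vanishing on the boundary,
positive inside, weak solution of `-Δ_p y = 1`. -/
def IsTorsionFn (p : ℝ) {N : ℕ} (U : Set (EuclideanSpace ℝ (Fin N)))
    (y : EuclideanSpace ℝ (Fin N) → ℝ) : Prop :=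
  C1OnClosure U y ∧ (∀ x ∈ frontier U, y x = 0) ∧ (∀ x ∈ U, 0 < y x) ∧
    IsWeakSolution p U y (fun _ => 1)

/-- A first eigenfunction of the Dirichlet `p`-Laplacian on `U`: `C^1` up to the boundary,
positive inside, vanishing on the boundary, `L^p`-normalized, weak solution of
`-Δ_p u = λ₁(U) u^{p-1}`. -/
def IsFirstEigenfun (p : ℝ) {N : ℕ} (U : Set (EuclideanSpace ℝ (Fin N)))
    (y : EuclideanSpace ℝ (Fin N) → ℝ) : Prop :=
  C1OnClosure U y ∧ (∀ x ∈ U, 0 < y x) ∧ (∀ x ∈ frontier U, y x = 0) ∧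
    (∫ x in U, y x ^ p) = 1 ∧
    IsWeakSolution p U y (fun x => pLambda1 p U * y x ^ (p - 1))

/-- The matrix `DA(x) = |x|^{p-2} I + (p-2)|x|^{p-4} x xᵀ`,
the derivative of `A(x) = |x|^{p-2} x`. -/
def DA (p : ℝ) {N : ℕ} (x : EuclideanSpace ℝ (Fin N)) :
    EuclideanSpace ℝ (Fin N) →L[ℝ] EuclideanSpace ℝ (Fin N) :=
  ‖x‖ ^ (p - 2) • ContinuousLinearMap.id ℝ (EuclideanSpace ℝ (Fin N)) +
    ((p - 2) * ‖x‖ ^ (p - 4)) • (innerSL ℝ x).smulRight x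

/-- `w` is a nonnegative bounded weak solution, continuous on the closure of `Ω` and `C^1`
inside, of `-Δ_p w = F(x, w)` in `Ω` with boundary value `bdry` on `∂Ω`. -/
def SolClass (p : ℝ) {N : ℕ} (Ω : Set (EuclideanSpace ℝ (Fin N)))
    (F : EuclideanSpace ℝ (Fin N) → ℝ → ℝ)
    (bdry w : EuclideanSpace ℝ (Fin N) → ℝ) : Prop :=
  ContinuousOn w (closure Ω) ∧ ContDiffOn ℝ 1 w Ω ∧
    (∀ x ∈ closure Ω, 0 ≤ w x) ∧ (∃ M, ∀ x ∈ closure Ω, |w x| ≤ M) ∧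
    IsWeakSolution p Ω w (fun x => F x (w x)) ∧ (∀ x ∈ frontier Ω, w x = bdry x)

section FluxMap

variable {E : Type*} [NormedAddCommGroup E] [InnerProductSpace ℝ E]

/-- The map `a ↦ |a|^{p-2} a` defining the `p`-Laplacian. -/
def fluxMap (p : ℝ) (a : E) : E := ‖a‖ ^ (p - 2) • a

lemma norm_fluxMap {p : ℝ} (hp : 1 < p) (a : E) : ‖fluxMap p a‖ = ‖a‖ ^ (p - 1) := by
  rcases eq_or_ne a 0 with rfl | ha
  · simp [fluxMap, Real.zero_rpow (by linarith : p - 1 ≠ 0)]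
  · have h : 0 < ‖a‖ := norm_pos_iff.2 ha
    rw [fluxMap, norm_smul, Real.norm_of_nonneg (by positivity)]
    nth_rewrite 2 [← Real.rpow_one ‖a‖]
    rw [← Real.rpow_add h]
    congr 1; ring

@[simp] lemma fluxMap_zero (p : ℝ) : fluxMap p (0 : E) = 0 := by simp [fluxMap]

lemma continuous_fluxMap {p : ℝ} (hp : 1 < p) : Continuous (fluxMap p : E → E) := by
  rw [continuous_iff_continuousAt]
  intro a
  rcases eq_or_ne a 0 with rfl | ha
  · rw [ContinuousAt, fluxMap_zero, tendsto_zero_iff_norm_tendsto_zero]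
    simp_rw [norm_fluxMap hp]
    have h : ContinuousAt (fun x : E => ‖x‖ ^ (p - 1)) 0 :=
      (continuous_norm.rpow_const (fun _ => Or.inr (by linarith))).continuousAt
    simpa [ContinuousAt, Real.zero_rpow (by linarith : p - 1 ≠ 0)] using h
  · exact (continuous_norm.continuousAt.rpow_const (Or.inl (norm_ne_zero_iff.2 ha))).smul
      continuousAt_id

lemma inner_fluxMap_sub_ge {p : ℝ} (hp : 1 < p) (a b : E) :
    (‖a‖ ^ (p - 1) - ‖b‖ ^ (p - 1)) * (‖a‖ - ‖b‖) + (‖a‖ ^ (p - 2) + ‖b‖ ^ (p - 2)) *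
      (‖a‖ * ‖b‖ - ⟪a, b⟫) = ⟪fluxMap p a - fluxMap p b, a - b⟫ := by
  have key : ∀ t : ℝ, 0 ≤ t → t ^ (p - 1) = t ^ (p - 2) * t := by
    intro t ht
    rcases ht.eq_or_lt with rfl | ht
    · simp [Real.zero_rpow (by linarith : p - 1 ≠ 0)]
    · nth_rewrite 3 [← Real.rpow_one t]
      rw [← Real.rpow_add ht]
      congr 1; ring
  simp only [fluxMap, inner_sub_left, inner_sub_right, real_inner_smul_left,
    real_inner_self_eq_norm_sq, real_inner_comm a b, key _ (norm_nonneg a), key _ (norm_nonneg b)]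
  ring

lemma inner_fluxMap_sub_nonneg {p : ℝ} (hp : 1 < p) (a b : E) :
    0 ≤ ⟪fluxMap p a - fluxMap p b, a - b⟫ := by
  rw [← inner_fluxMap_sub_ge hp]
  have h1 : 0 ≤ (‖a‖ ^ (p - 1) - ‖b‖ ^ (p - 1)) * (‖a‖ - ‖b‖) := by
    rcases le_total ‖a‖ ‖b‖ with h | h
    · have := Real.rpow_le_rpow (norm_nonneg a) h (by linarith : 0 ≤ p - 1)
      exact mul_nonneg_of_nonpos_of_nonpos (by linarith) (by linarith)
    · have := Real.rpow_le_rpow (norm_nonneg b) h (by linarith : 0 ≤ p - 1)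
      exact mul_nonneg (by linarith) (by linarith)
  have h2 := real_inner_le_norm a b
  have : 0 ≤ (‖a‖ ^ (p - 2) + ‖b‖ ^ (p - 2)) * (‖a‖ * ‖b‖ - ⟪a, b⟫) :=
    mul_nonneg (by positivity) (by linarith)
  linarith

lemma eq_of_inner_fluxMap_sub_eq_zero {p : ℝ} (hp : 1 < p) {a b : E}
    (h : ⟪fluxMap p a - fluxMap p b, a - b⟫ = 0) : a = b := by
  rw [← inner_fluxMap_sub_ge hp] at h
  have h2 := real_inner_le_norm a b
  have h3 : 0 ≤ (‖a‖ ^ (p - 2) + ‖b‖ ^ (p - 2)) * (‖a‖ * ‖b‖ - ⟪a, b⟫) :=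
    mul_nonneg (by positivity) (by linarith)
  have hn : ‖a‖ = ‖b‖ := by
    rcases lt_trichotomy ‖a‖ ‖b‖ with hl | hl | hl
    · have := Real.rpow_lt_rpow (norm_nonneg a) hl (by linarith : 0 < p - 1)
      have := mul_pos_of_neg_of_neg (sub_neg.2 this) (sub_neg.2 hl)
      linarith
    · exact hl
    · have := Real.rpow_lt_rpow (norm_nonneg b) hl (by linarith : 0 < p - 1)
      have := mul_pos (sub_pos.2 this) (sub_pos.2 hl)
      linarith
  rcases eq_or_ne a 0 with rfl | ha
  · exact (norm_eq_zero.1 (by simpa using hn.symm)).symm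
  · have hpos : 0 < ‖a‖ := norm_pos_iff.2 ha
    have hpos' : 0 < ‖a‖ ^ (p - 2) := Real.rpow_pos_of_pos hpos _
    rw [← hn] at h
    have h4 : ‖a‖ * ‖a‖ - ⟪a, b⟫ = 0 := by
      have : (‖a‖ ^ (p - 2) + ‖a‖ ^ (p - 2)) * (‖a‖ * ‖a‖ - ⟪a, b⟫) = 0 := by linarith
      rcases mul_eq_zero.1 this with h | h
      · linarith
      · exact h
    have h5 : ‖a - b‖ ^ 2 = 0 := by
      rw [norm_sub_sq_real, ← hn]; nlinarith
    exact sub_eq_zero.1 (norm_eq_zero.1 (by simpa using h5))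

lemma fluxMap_local_bounds {p : ℝ} (hp : 1 < p) {a : E} (ha : a ≠ 0) :
    ∃ c > 0, ∃ C > 0, ∃ U ∈ nhds a, ∀ b ∈ U, ∀ b' ∈ U,
      c * ‖b - b'‖ ^ 2 ≤ ⟪fluxMap p b - fluxMap p b', b - b'⟫ ∧
      ‖fluxMap p b - fluxMap p b'‖ ≤ C * ‖b - b'‖ := by
  have hpos : 0 < ‖a‖ := norm_pos_iff.2 ha
  have h1 : HasStrictFDerivAt (fun x : E => ‖x‖ ^ 2) (2 • (innerSL ℝ a)) a :=
    hasStrictFDerivAt_norm_sq a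
  have h2 := h1.rpow_const (p := (p - 2) / 2) (Or.inl (by positivity))
  have h3 := h2.smul (hasStrictFDerivAt_id a)
  have hfun : ((fun x : E => (‖x‖ ^ 2) ^ ((p - 2) / 2)) • (fun x : E => x)) = fluxMap p := by
    funext x
    simp only [Pi.smul_apply', fluxMap]
    rw [← Real.rpow_natCast, ← Real.rpow_mul (norm_nonneg x)]
    congr 2; push_cast; ring
  have h4 := h3
  change HasStrictFDerivAt ((fun x : E => (‖x‖ ^ 2) ^ ((p - 2) / 2)) • (fun x : E => x)) _ a at h4
  rw [hfun] at h4
  set D := (‖a‖ ^ 2) ^ ((p - 2) / 2) • ContinuousLinearMap.id ℝ E +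
    ContinuousLinearMap.smulRight (((p - 2) / 2 * (‖a‖ ^ 2) ^ ((p - 2) / 2 - 1)) •
      2 • (innerSL ℝ) a) (id a) with hD
  have h4 : HasStrictFDerivAt (fluxMap p) D a := h4
  set k := (‖a‖ ^ 2) ^ ((p - 2) / 2 - 1) with hk
  have hkpos : 0 < k := by positivity
  have hk2 : (‖a‖ ^ 2) ^ ((p - 2) / 2) = k * ‖a‖ ^ 2 := by
    rw [hk]
    nth_rewrite 3 [← Real.rpow_one (‖a‖ ^ 2)]
    rw [← Real.rpow_add (by positivity)]
    congr 1; ring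
  set m := min 1 (p - 1) with hm
  have hmpos : 0 < m := lt_min one_pos (by linarith)
  have hcoer : ∀ h : E, (m * (k * ‖a‖ ^ 2)) * ‖h‖ ^ 2 ≤ ⟪D h, h⟫ := by
    intro h
    have hDh : ⟪D h, h⟫ = k * (‖a‖ ^ 2 * ‖h‖ ^ 2 + (p - 2) * ⟪a, h⟫ ^ 2) := by
      simp only [hD, hk2, add_apply, smul_apply,
        ContinuousLinearMap.id_apply, ContinuousLinearMap.smulRight_apply, inner_add_left,
        real_inner_smul_left, innerSL_apply_apply, id, real_inner_self_eq_norm_sq, smul_eq_mul,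
        nsmul_eq_mul]
      push_cast
      ring
    rw [hDh]
    have hcs : ⟪a, h⟫ ^ 2 ≤ ‖a‖ ^ 2 * ‖h‖ ^ 2 := by
      have := abs_real_inner_le_norm a h
      rw [← sq_abs, ← mul_pow]
      gcongr
    have hm1 : m ≤ 1 := min_le_left _ _
    have hm2 : m ≤ p - 1 := min_le_right _ _
    have : m * (‖a‖ ^ 2 * ‖h‖ ^ 2) ≤ ‖a‖ ^ 2 * ‖h‖ ^ 2 + (p - 2) * ⟪a, h⟫ ^ 2 := by
      nlinarith [sq_nonneg ⟪a, h⟫]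
    nlinarith
  set c0 := m * (k * ‖a‖ ^ 2) with hc0
  have hc0pos : 0 < c0 := by positivity
  have hev := h4.isLittleO.def (c := c0 / 2) (by positivity)
  rw [nhds_prod_eq, Filter.eventually_prod_self_iff'] at hev
  obtain ⟨U, hU, hb⟩ := hev
  refine ⟨c0 / 2, by positivity, ‖D‖ + c0 / 2, by positivity, U, hU, fun b hbU b' hbU' => ?_⟩
  have hbb := hb b hbU b' hbU'
  simp only at hbb
  set r := fluxMap p b - fluxMap p b' - D (b - b') with hr
  have hsplit : fluxMap p b - fluxMap p b' = D (b - b') + r := by rw [hr]; abel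
  rw [hsplit]
  constructor
  · rw [inner_add_left]
    have h5 := hcoer (b - b')
    have h6 := abs_real_inner_le_norm r (b - b')
    have h7 := neg_abs_le ⟪r, b - b'⟫
    have h8 : ‖r‖ * ‖b - b'‖ ≤ c0 / 2 * ‖b - b'‖ * ‖b - b'‖ := by gcongr
    nlinarith
  · calc ‖D (b - b') + r‖ ≤ ‖D (b - b')‖ + ‖r‖ := norm_add_le _ _
      _ ≤ ‖D‖ * ‖b - b'‖ + c0 / 2 * ‖b - b'‖ := add_le_add (D.le_opNorm _) hbb
      _ = _ := by ring

end FluxMap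

section TestFunctions

variable {E : Type*} [NormedAddCommGroup E] [InnerProductSpace ℝ E] [FiniteDimensional ℝ E]

lemma continuousOn_gradient {f : E → ℝ} {U : Set E} (hU : IsOpen U) (hf : ContDiffOn ℝ 1 f U) :
    ContinuousOn (gradient f) U :=
  (InnerProductSpace.toDual ℝ E).symm.continuous.comp_continuousOn
    (hf.continuousOn_fderiv_of_isOpen hU le_rfl)

lemma continuous_gradient {f : E → ℝ} (hf : ContDiff ℝ 1 f) : Continuous (gradient f) :=
  (InnerProductSpace.toDual ℝ E).symm.continuous.comp (hf.continuous_fderiv one_ne_zero)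

lemma tsupport_gradient_subset (f : E → ℝ) : tsupport (gradient f) ⊆ tsupport f := by
  refine (closure_mono ?_).trans (tsupport_fderiv_subset ℝ (f := f))
  refine Function.support_subset_iff'.2 fun x hx => ?_
  rw [Function.notMem_support] at hx
  simp [gradient, hx]

lemma gradient_eq_zero_of_notMem_tsupport {f : E → ℝ} {x : E} (hx : x ∉ tsupport f) :
    gradient f x = 0 :=
  image_eq_zero_of_notMem_tsupport fun h => hx (tsupport_gradient_subset f h)

/-- `C^1` functions with compact support in `U`. -/
def IsC1Test (U : Set E) (φ : E → ℝ) : Prop :=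
  ContDiff ℝ 1 φ ∧ HasCompactSupport φ ∧ tsupport φ ⊆ U

omit [FiniteDimensional ℝ E] in
lemma IsC1Test.mono {U V : Set E} {φ : E → ℝ} (h : IsC1Test U φ) (hUV : U ⊆ V) : IsC1Test V φ :=
  ⟨h.1, h.2.1, h.2.2.trans hUV⟩

lemma tsupport_inner_gradient_subset (F : E → E) (φ : E → ℝ) :
    tsupport (fun x => ⟪F x, gradient φ x⟫) ⊆ tsupport φ := by
  refine closure_minimal (fun x hx => ?_) (isClosed_tsupport φ)
  by_contra h
  exact hx (by simp [gradient_eq_zero_of_notMem_tsupport h])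

lemma IsC1Test.continuous_inner {U : Set E} (hU : IsOpen U) {F : E → E} (hF : ContinuousOn F U)
    {φ : E → ℝ} (hφ : IsC1Test U φ) : Continuous (fun x => ⟪F x, gradient φ x⟫) :=
  continuous_of_tsupport fun _ hx =>
    (hF.continuousAt (hU.mem_nhds (hφ.2.2 (tsupport_inner_gradient_subset F φ hx)))).inner
      (continuous_gradient hφ.1).continuousAt

variable [MeasurableSpace E] [BorelSpace E]

lemma IsC1Test.integrable_inner {U : Set E} (hU : IsOpen U) {F : E → E} (hF : ContinuousOn F U)
    {φ : E → ℝ} (hφ : IsC1Test U φ) : Integrable (fun x => ⟪F x, gradient φ x⟫) :=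
  (hφ.continuous_inner hU hF).integrable_of_hasCompactSupport
    (hφ.2.1.mono' ((subset_tsupport _).trans (tsupport_inner_gradient_subset F φ)))

lemma IsC1Test.integrable {U : Set E} {φ : E → ℝ} (hφ : IsC1Test U φ) : Integrable φ :=
  hφ.1.continuous.integrable_of_hasCompactSupport hφ.2.1

open scoped Convolution in
lemma IsC1Test.exists_smooth_approx {U : Set E} (hU : IsOpen U) {φ : E → ℝ} (hφ : IsC1Test U φ) :
    ∃ K, IsCompact K ∧ K ⊆ U ∧ tsupport φ ⊆ K ∧ ∀ ε > 0, ∃ ψ : E → ℝ,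
      ContDiff ℝ (⊤ : ℕ∞) ψ ∧ tsupport ψ ⊆ K ∧ (∀ x, |ψ x - φ x| ≤ ε) ∧
        ∀ x, ‖gradient ψ x - gradient φ x‖ ≤ ε := by
  obtain ⟨hC, hK, hsub⟩ := hφ
  obtain ⟨δ, hδ, hδU⟩ := hK.isCompact.exists_cthickening_subset_open hU hsub
  refine ⟨cthickening δ (tsupport φ), hK.isCompact.cthickening, hδU,
    self_subset_cthickening _, fun ε hε => ?_⟩
  have huc1 := hK.uniformContinuous_of_continuous hC.continuous
  have hK' : HasCompactSupport (fderiv ℝ φ) := hK.fderiv ℝ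
  have huc2 := hK'.uniformContinuous_of_continuous (hC.continuous_fderiv one_ne_zero)
  obtain ⟨δ1, hδ1, h1⟩ := Metric.uniformContinuous_iff.1 huc1 ε hε
  obtain ⟨δ2, hδ2, h2⟩ := Metric.uniformContinuous_iff.1 huc2 ε hε
  set r := min δ (min δ1 δ2) with hr
  have hrpos : 0 < r := lt_min hδ (lt_min hδ1 hδ2)
  let b : ContDiffBump (0 : E) := ⟨r / 2, r, by positivity, by linarith⟩
  set ψ : E → ℝ := (b.normed volume ⋆[ContinuousLinearMap.lsmul ℝ ℝ, volume] φ) with hψ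
  have hlocφ : LocallyIntegrable φ := hC.continuous.locallyIntegrable
  have hder : ∀ x, HasFDerivAt ψ ((b.normed volume
      ⋆[(ContinuousLinearMap.lsmul ℝ ℝ).precompR E, volume] fderiv ℝ φ) x) x := fun x =>
    hK.hasFDerivAt_convolution_right _ (b.continuous_normed.locallyIntegrable) hC x
  have hprec : (ContinuousLinearMap.lsmul ℝ ℝ : ℝ →L[ℝ] ℝ →L[ℝ] ℝ).precompR E =
      ContinuousLinearMap.lsmul ℝ ℝ := by
    ext a f
    simp
  rw [hprec] at hder
  refine ⟨ψ, ?_, ?_, fun x => ?_, fun x => ?_⟩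
  · exact b.hasCompactSupport_normed.contDiff_convolution_left _ b.contDiff_normed hlocφ
  · refine closure_minimal ?_ isClosed_cthickening
    refine (support_convolution_subset _).trans ?_
    rw [b.support_normed_eq]
    rintro _ ⟨u, hu, v, hv, rfl⟩
    refine mem_cthickening_of_dist_le _ v _ _ (subset_tsupport _ hv) ?_
    have : ‖u‖ < r := by simpa [b] using hu
    simp only [dist_eq_norm]
    rw [add_sub_cancel_right]
    exact this.le.trans (min_le_left _ _)
  · rw [← Real.dist_eq]
    refine ContDiffBump.dist_normed_convolution_le hC.continuous.aestronglyMeasurable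
      fun z hz => (h1 ?_).le
    exact lt_of_lt_of_le (mem_ball.1 hz) ((min_le_right _ _).trans (min_le_left _ _))
  · have : gradient ψ x - gradient φ x =
        (InnerProductSpace.toDual ℝ E).symm (fderiv ℝ ψ x - fderiv ℝ φ x) := by
      simp [gradient]
    rw [this, LinearIsometryEquiv.norm_map, (hder x).fderiv, ← dist_eq_norm]
    refine ContDiffBump.dist_normed_convolution_le
      (hC.continuous_fderiv one_ne_zero).aestronglyMeasurable
      fun z hz => (h2 ?_).le
    exact lt_of_lt_of_le (mem_ball.1 hz) ((min_le_right _ _).trans (min_le_right _ _))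

/-- `-div F = h` weakly in `U`, tested against `C^1` functions. -/
def IsWeakDiv (U : Set E) (F : E → E) (h : ℝ) : Prop :=
  ∀ φ : E → ℝ, IsC1Test U φ → ∫ x, ⟪F x, gradient φ x⟫ = h * ∫ x, φ x

lemma IsWeakDiv.mono {U V : Set E} {F : E → E} {h : ℝ} (hF : IsWeakDiv V F h) (hUV : U ⊆ V) :
    IsWeakDiv U F h := fun φ hφ => hF φ (hφ.mono hUV)

lemma IsWeakDiv.sub {U : Set E} (hU : IsOpen U) {F G : E → E} {h k : ℝ} (hFc : ContinuousOn F U)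
    (hGc : ContinuousOn G U) (hF : IsWeakDiv U F h) (hG : IsWeakDiv U G k) :
    IsWeakDiv U (fun x => F x - G x) (h - k) := by
  intro φ hφ
  simp_rw [inner_sub_left]
  rw [integral_sub (hφ.integrable_inner hU hFc) (hφ.integrable_inner hU hGc), hF φ hφ, hG φ hφ]
  ring

lemma isWeakDiv_of_smooth {U : Set E} (hU : IsOpen U) {F : E → E} (hF : ContinuousOn F U) {h : ℝ}
    (hw : ∀ φ : E → ℝ, ContDiff ℝ (⊤ : ℕ∞) φ → HasCompactSupport φ → tsupport φ ⊆ U →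
      ∫ x, ⟪F x, gradient φ x⟫ = h * ∫ x, φ x) : IsWeakDiv U F h := by
  intro φ hφ
  obtain ⟨K, hKc, hKU, hφK, happ⟩ := hφ.exists_smooth_approx hU
  obtain ⟨B, hB⟩ := hKc.exists_bound_of_continuousOn (hF.mono hKU)
  have hB' : ∀ x ∈ K, ‖F x‖ ≤ |B| := fun x hx => (hB x hx).trans (le_abs_self B)
  have hvol : volume K < ⊤ := hKc.measure_lt_top
  set V := volume.real K with hV
  have hVn : 0 ≤ V := measureReal_nonneg
  have key : ∀ ε > 0, |(∫ x, ⟪F x, gradient φ x⟫) - h * ∫ x, φ x| ≤ ε * ((|B| + |h|) * V) := by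
    intro ε hε
    obtain ⟨ψ, hψ, hψK, h0, h1⟩ := happ ε hε
    have hψc : HasCompactSupport ψ := HasCompactSupport.of_support_subset_isCompact hKc
      ((subset_tsupport _).trans hψK)
    have hψt : IsC1Test U ψ := ⟨hψ.of_le (by exact_mod_cast le_top), hψc, hψK.trans hKU⟩
    have e1 := hw ψ hψ hψc (hψK.trans hKU)
    have e2 : (∫ x, ⟪F x, gradient φ x⟫) - ∫ x, ⟪F x, gradient ψ x⟫ =
        ∫ x in K, ⟪F x, gradient φ x - gradient ψ x⟫ := by
      rw [← integral_sub (hφ.integrable_inner hU hF) (hψt.integrable_inner hU hF),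
        setIntegral_eq_integral_of_forall_compl_eq_zero]
      · simp_rw [inner_sub_right]
      · intro x hx
        rw [gradient_eq_zero_of_notMem_tsupport fun h => hx (hφK h),
          gradient_eq_zero_of_notMem_tsupport fun h => hx (hψK h)]
        simp
    have e3 : (∫ x, φ x) - ∫ x, ψ x = ∫ x in K, (φ x - ψ x) := by
      rw [← integral_sub hφ.integrable hψt.integrable,
        setIntegral_eq_integral_of_forall_compl_eq_zero]
      intro x hx
      rw [image_eq_zero_of_notMem_tsupport fun h => hx (hφK h),
          image_eq_zero_of_notMem_tsupport fun h => hx (hψK h)]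
      simp
    have b2 : ‖∫ x in K, ⟪F x, gradient φ x - gradient ψ x⟫‖ ≤ (|B| * ε) * V := by
      refine norm_setIntegral_le_of_norm_le_const hvol fun x hx => ?_
      refine (norm_inner_le_norm _ _).trans ?_
      rw [norm_sub_rev]
      exact mul_le_mul (hB' x hx) (h1 x) (norm_nonneg _) (abs_nonneg _)
    have b3 : ‖∫ x in K, (φ x - ψ x)‖ ≤ ε * V := by
      refine norm_setIntegral_le_of_norm_le_const hvol fun x hx => ?_
      rw [norm_sub_rev]
      exact h0 x
    rw [← e2, Real.norm_eq_abs] at b2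
    rw [← e3, Real.norm_eq_abs] at b3
    have : (∫ x, ⟪F x, gradient φ x⟫) - h * ∫ x, φ x =
      ((∫ x, ⟪F x, gradient φ x⟫) - ∫ x, ⟪F x, gradient ψ x⟫) -
        h * ((∫ x, φ x) - ∫ x, ψ x) := by rw [e1]; ring
    rw [this]
    refine (abs_sub _ _).trans ?_
    rw [abs_mul]
    have := mul_le_mul_of_nonneg_left b3 (abs_nonneg h)
    nlinarith
  have h0 : |(∫ x, ⟪F x, gradient φ x⟫) - h * ∫ x, φ x| ≤ 0 := by
    refine le_of_forall_pos_le_add fun δ hδ => ?_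
    have hpos : 0 < (|B| + |h|) * V + 1 := by positivity
    refine (key (δ / ((|B| + |h|) * V + 1)) (by positivity)).trans ?_
    rw [zero_add, div_mul_eq_mul_div, div_le_iff₀ hpos]
    nlinarith
  exact sub_eq_zero.1 (abs_nonpos_iff.1 h0)

end TestFunctions

section Comparison

variable {E : Type*} [NormedAddCommGroup E] [InnerProductSpace ℝ E] [FiniteDimensional ℝ E]

omit [InnerProductSpace ℝ E] [FiniteDimensional ℝ E] in
lemma contDiff_of_contDiffAt_tsupport [NormedSpace ℝ E] {n : WithTop ℕ∞} {f : E → ℝ}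
    (hf : ∀ x ∈ tsupport f, ContDiffAt ℝ n f x) : ContDiff ℝ n f := by
  refine contDiff_iff_contDiffAt.2 fun x => ?_
  by_cases hx : x ∈ tsupport f
  · exact hf x hx
  · exact contDiffAt_const.congr_of_eventuallyEq (notMem_tsupport_iff_eventuallyEq.1 hx)

lemma hasGradientAt_of_contDiffOn {f : E → ℝ} {U : Set E} (hU : IsOpen U)
    (hf : ContDiffOn ℝ 1 f U) {x : E} (hx : x ∈ U) : HasGradientAt f (gradient f x) x :=
  ((hf.contDiffAt (hU.mem_nhds hx)).differentiableAt one_ne_zero).hasGradientAt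

lemma HasGradientAt.scomp {f : E → ℝ} {θ : ℝ → ℝ} {f' x : E} {θ' : ℝ}
    (hθ : HasDerivAt θ θ' (f x)) (hf : HasGradientAt f f' x) :
    HasGradientAt (fun x => θ (f x)) (θ' • f') x := by
  rw [hasGradientAt_iff_hasFDerivAt] at hf ⊢
  rw [map_smulₛₗ]
  exact hθ.comp_hasFDerivAt x hf

variable [MeasurableSpace E] [BorelSpace E]

/-- Comparison principle for the `p`-Laplacian. -/
lemma le_of_isWeakDiv_fluxMap [Nontrivial E] {p : ℝ} (hp : 1 < p) {O : Set E} (hO : IsOpen O)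
    (hb : Bornology.IsBounded O) {u v : E → ℝ} {h : ℝ}
    (huc : ContinuousOn u (closure O)) (hvc : ContinuousOn v (closure O))
    (hu : ContDiffOn ℝ 1 u O) (hv : ContDiffOn ℝ 1 v O)
    (hwu : IsWeakDiv O (fun x => fluxMap p (gradient u x)) h)
    (hwv : IsWeakDiv O (fun x => fluxMap p (gradient v x)) h)
    (hfr : ∀ x ∈ closure O, x ∉ O → u x ≤ v x) {x : E} (hx : x ∈ O) : u x ≤ v x := by
  classical
  refine le_of_forall_pos_le_add fun ε hε => ?_
  set θ : ℝ → ℝ := Real.smoothTransition with hθ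
  have hθd : ContDiff ℝ 1 θ := Real.smoothTransition.contDiff
  have hθmono : ∀ t, 0 ≤ deriv θ t := fun t => Real.smoothTransition.monotone.deriv_nonneg
  set φ : E → ℝ := fun z => if z ∈ O then θ (u z - v z - ε) else 0 with hφ
  set S : Set E := closure O ∩ (fun z => u z - v z) ⁻¹' Ici ε with hS
  have hSc : IsClosed S :=
    (huc.sub hvc).preimage_isClosed_of_isClosed isClosed_closure isClosed_Ici
  have hSO : S ⊆ O := by
    rintro z ⟨hz1, hz2⟩
    by_contra hz
    have := hfr z hz1 hz
    have hz2' : ε ≤ u z - v z := hz2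
    linarith
  have hsupp : Function.support φ ⊆ S := by
    intro z hz
    have hzO : z ∈ O := by
      by_contra h'
      exact hz (by simp [hφ, h'])
    refine ⟨subset_closure hzO, ?_⟩
    by_contra hlt
    have hlt' : u z - v z < ε := not_le.1 hlt
    refine hz ?_
    simp only [hφ, hzO, if_true]
    exact Real.smoothTransition.zero_of_nonpos (by linarith)
  have htS : tsupport φ ⊆ S := closure_minimal hsupp hSc
  have hScomp : IsCompact S :=
    (hb.isCompact_closure).of_isClosed_subset hSc inter_subset_left
  have hcomp : HasCompactSupport φ := HasCompactSupport.of_support_subset_isCompact hScomp hsupp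
  have heq : ∀ z ∈ O, φ =ᶠ[nhds z] fun z => θ (u z - v z - ε) := by
    intro z hz
    filter_upwards [hO.mem_nhds hz] with z' hz'
    simp [hφ, hz']
  have hgrad : ∀ z ∈ O, gradient φ z =
      deriv θ (u z - v z - ε) • (gradient u z - gradient v z) := by
    intro z hz
    have h1 := (hasGradientAt_of_contDiffOn hO hu hz).hasFDerivAt.sub
      (hasGradientAt_of_contDiffOn hO hv hz).hasFDerivAt
    have h2 : HasGradientAt (fun z => u z - v z - ε) (gradient u z - gradient v z) z := by
      rw [hasGradientAt_iff_hasFDerivAt, map_sub]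
      exact h1.sub_const ε
    have h3 := HasGradientAt.scomp (f := fun z => u z - v z - ε)
      ((hθd.differentiable one_ne_zero (u z - v z - ε)).hasDerivAt) h2
    have h4 : gradient φ z = gradient (fun z => θ (u z - v z - ε)) z := by
      simp only [gradient, (heq z hz).fderiv_eq]
    rw [h4, h3.gradient]
  have hφC : ContDiff ℝ 1 φ := by
    refine contDiff_of_contDiffAt_tsupport fun z hz => ?_
    have hzO := hSO (htS hz)
    refine ContDiffAt.congr_of_eventuallyEq ?_ (heq z hzO)
    exact hθd.contDiffAt.comp z (((hu.contDiffAt (hO.mem_nhds hzO)).sub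
      (hv.contDiffAt (hO.mem_nhds hzO))).sub contDiffAt_const)
  have hφt : IsC1Test O φ := ⟨hφC, hcomp, htS.trans hSO⟩
  have hFu := (continuous_fluxMap (E := E) hp).comp_continuousOn (continuousOn_gradient hO hu)
  have hFv := (continuous_fluxMap (E := E) hp).comp_continuousOn (continuousOn_gradient hO hv)
  have hinteg := (hwu.sub hO hFu hFv hwv) φ hφt
  rw [sub_self, zero_mul] at hinteg
  have hcont : Continuous (fun z => ⟪fluxMap p (gradient u z) - fluxMap p (gradient v z),
      gradient φ z⟫) := hφt.continuous_inner hO (hFu.sub hFv)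
  have hpos : ∀ z, 0 ≤ ⟪fluxMap p (gradient u z) - fluxMap p (gradient v z), gradient φ z⟫ := by
    intro z
    by_cases hz : z ∈ O
    · rw [hgrad z hz, inner_smul_right]
      exact mul_nonneg (hθmono _) (inner_fluxMap_sub_nonneg hp _ _)
    · rw [gradient_eq_zero_of_notMem_tsupport fun h' => hz (hSO (htS h')), inner_zero_right]
  have hae := (integral_eq_zero_iff_of_nonneg hpos (hφt.integrable_inner hO (hFu.sub hFv))).1 hinteg
  have hz0 := (hcont.ae_eq_iff_eq volume continuous_const).1 hae
  have hg0 : ∀ z, gradient φ z = 0 := by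
    intro z
    by_cases hz : z ∈ O
    · have h1 := congrFun hz0 z
      simp only [hgrad z hz, inner_smul_right] at h1
      rcases mul_eq_zero.1 h1 with h2 | h2
      · rw [hgrad z hz, h2, zero_smul]
      · rw [hgrad z hz, eq_of_inner_fluxMap_sub_eq_zero hp h2, sub_self, smul_zero]
    · exact gradient_eq_zero_of_notMem_tsupport fun h' => hz (hSO (htS h'))
  have hf0 : ∀ z, fderiv ℝ φ z = 0 := fun z => by
    have := hg0 z
    simpa [gradient] using this
  have hconst := is_const_of_fderiv_eq_zero (hφC.differentiable one_ne_zero) hf0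
  obtain ⟨w, hw⟩ : ∃ w, w ∉ tsupport φ := by
    by_contra! hall
    have : NoncompactSpace E := NormedSpace.noncompactSpace ℝ E
    exact noncompact_univ E ((eq_univ_of_forall hall) ▸ hcomp)
  have hφx : φ x = 0 := by rw [hconst x w]; exact image_eq_zero_of_notMem_tsupport hw
  simp only [hφ, hx, if_true] at hφx
  by_contra hlt
  have : 0 < u x - v x - ε := by linarith
  exact absurd hφx (Real.smoothTransition.pos_of_pos this).ne'

lemma integral_inner_sub_gradient {φ : E → ℝ} (hφ : ContDiff ℝ 1 φ) (hc : HasCompactSupport φ)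
    (q : E) :
    ∫ x, ⟪x - q, gradient φ x⟫ = -(Module.finrank ℝ E : ℝ) * ∫ x, φ x := by
  set b := stdOrthonormalBasis ℝ E
  have hT : IsC1Test univ φ := ⟨hφ, hc, subset_univ _⟩
  have hfd : ∀ i, HasCompactSupport (fun x => ⟪x - q, b i⟫ * fderiv ℝ φ x (b i)) := fun i =>
    ((hc.fderiv_apply ℝ (b i))).mul_left
  have hfc : ∀ i, Continuous (fun x => fderiv ℝ φ x (b i)) := fun i =>
    (hφ.continuous_fderiv one_ne_zero).clm_apply continuous_const
  have hic : ∀ i, Continuous (fun x => ⟪x - q, b i⟫) := fun i => by fun_prop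
  have hd : ∀ i x, HasFDerivAt (fun x => ⟪x - q, b i⟫) (innerSL ℝ (b i)) x := fun i x => by
    have : (fun x => ⟪x - q, b i⟫) = fun x => innerSL ℝ (b i) x - ⟪q, b i⟫ := by
      ext x
      simp [inner_sub_left, real_inner_comm]
    rw [this]
    exact (innerSL ℝ (b i)).hasFDerivAt.sub_const _
  have e1 : ∀ x, ⟪x - q, gradient φ x⟫ = ∑ i, ⟪x - q, b i⟫ * fderiv ℝ φ x (b i) := by
    intro x
    rw [← b.sum_inner_mul_inner]
    refine Finset.sum_congr rfl fun i _ => ?_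
    rw [real_inner_comm (gradient φ x), inner_gradient_left]
  have e2 : ∀ i, ∫ x, ⟪x - q, b i⟫ * fderiv ℝ φ x (b i) = - ∫ x, φ x := by
    intro i
    rw [integral_mul_fderiv_eq_neg_fderiv_mul_of_integrable]
    · congr 1
      refine integral_congr_ae (.of_forall fun x => ?_)
      simp [(hd i x).fderiv]
    · have : (fun x => fderiv ℝ (fun x => ⟪x - q, b i⟫) x (b i) * φ x) = φ := by
        ext x
        simp [(hd i x).fderiv]
      rw [this]
      exact hT.integrable
    · exact ((hic i).mul (hfc i)).integrable_of_hasCompactSupport (hfd i)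
    · exact ((hic i).mul hφ.continuous).integrable_of_hasCompactSupport hc.mul_left
    · exact fun x _ => (hd i x).differentiableAt
    · exact fun x _ => hφ.differentiable one_ne_zero x
  simp_rw [e1]
  rw [integral_finsetSum (f := fun i x => ⟪x - q, b i⟫ * fderiv ℝ φ x (b i)) _ fun i _ =>
    ((hic i).mul (hfc i)).integrable_of_hasCompactSupport (hfd i)]
  simp [e2, Finset.sum_const]

end Comparison

section Hopf

variable {E : Type*} [NormedAddCommGroup E] [InnerProductSpace ℝ E]

lemma hasGradientAt_norm_sub_rpow [CompleteSpace E] (q x : E) {r : ℝ} (hr : 1 < r) :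
    HasGradientAt (fun x => ‖x - q‖ ^ r) ((r * ‖x - q‖ ^ (r - 2)) • (x - q)) x := by
  rw [hasGradientAt_iff_hasFDerivAt]
  have h := (hasFDerivAt_norm_rpow (x - q) hr).comp x ((hasFDerivAt_id x).sub_const q)
  refine h.congr_fderiv ?_
  ext z
  simp

lemma fluxMap_barrier {p κ : ℝ} (hp : 1 < p) (hκ : 0 < κ) (w : E) :
    fluxMap p (-(κ * ‖w‖ ^ (p / (p - 1) - 2)) • w) = -(κ ^ (p - 1)) • w := by
  have hp0 : p - 1 ≠ 0 := by linarith
  rcases eq_or_ne w 0 with rfl | hw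
  · simp
  have hw0 : 0 < ‖w‖ := norm_pos_iff.2 hw
  have hn : ‖-(κ * ‖w‖ ^ (p / (p - 1) - 2)) • w‖ = κ * ‖w‖ ^ (p / (p - 1) - 1) := by
    rw [norm_smul, norm_neg, Real.norm_of_nonneg (by positivity), mul_assoc]
    congr 1
    rw [← Real.rpow_add_one hw0.ne']
    congr 1
    ring
  rw [fluxMap, hn, smul_smul]
  congr 1
  rw [Real.mul_rpow hκ.le (by positivity), ← Real.rpow_mul hw0.le, mul_neg, neg_inj]
  calc κ ^ (p - 2) * ‖w‖ ^ ((p / (p - 1) - 1) * (p - 2)) * (κ * ‖w‖ ^ (p / (p - 1) - 2))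
      = (κ ^ (p - 2) * κ) * (‖w‖ ^ ((p / (p - 1) - 1) * (p - 2)) * ‖w‖ ^ (p / (p - 1) - 2)) := by
        ring
    _ = κ ^ (p - 1) * ‖w‖ ^ (0 : ℝ) := by
        rw [← Real.rpow_add_one hκ.ne', ← Real.rpow_add hw0]
        congr 2
        · ring
        · field_simp
          ring
    _ = κ ^ (p - 1) := by simp

variable [FiniteDimensional ℝ E] [MeasurableSpace E] [BorelSpace E]

/-- Hopf's lemma for `-Δ_p y = 1` in a ball. -/
lemma inner_gradient_pos_of_isWeakDiv_ball [Nontrivial E] {p : ℝ} (hp : 1 < p) {q : E} {R : ℝ}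
    (hR : 0 < R) {y : E → ℝ} {W : Set E} (hW : IsOpen W) (hBW : closedBall q R ⊆ W)
    (hy : ContDiffOn ℝ 1 y W)
    (hwy : IsWeakDiv (ball q R) (fun x => fluxMap p (gradient y x)) 1) {M : ℝ}
    (hM : ∀ x ∈ sphere q R, M ≤ y x) {z : E} (hz : z ∈ sphere q R) (hyz : y z = M) :
    0 < ⟪gradient y z, q - z⟫ := by
  set p' := p / (p - 1) with hp'
  have hp1 : 0 < p - 1 := by linarith
  have hp'1 : 1 < p' := by rw [hp', lt_div_iff₀ hp1]; linarith
  have hN : 0 < (Module.finrank ℝ E : ℝ) := by exact_mod_cast Module.finrank_pos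
  set n : ℝ := (Module.finrank ℝ E : ℝ)
  set c := (n⁻¹) ^ (p - 1)⁻¹ with hc
  have hc0 : 0 < c := by positivity
  have hcp : c ^ (p - 1) = n⁻¹ := Real.rpow_inv_rpow (by positivity) hp1.ne'
  set κ := c / p' with hκ
  have hκ0 : 0 < κ := by positivity
  set β : E → ℝ := fun x => M + κ * (R ^ p' - ‖x - q‖ ^ p') with hβ
  have hβg : ∀ x, gradient β x = -(c * ‖x - q‖ ^ (p' - 2)) • (x - q) := by
    intro x
    have h1 := (hasGradientAt_norm_sub_rpow q x hp'1).hasFDerivAt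
    have h2 : HasFDerivAt β (κ • -(InnerProductSpace.toDual ℝ E)
        ((p' * ‖x - q‖ ^ (p' - 2)) • (x - q))) x := ((h1.const_sub _).const_mul κ).const_add M
    rw [← map_neg, ← map_smul, ← hasGradientAt_iff_hasFDerivAt] at h2
    rw [h2.gradient, ← neg_smul, smul_smul]
    congr 1
    rw [hκ]
    field_simp
  have hβC : ContDiff ℝ 1 β := by
    have := (contDiff_norm_rpow (E := E) hp'1).comp (contDiff_id.sub (contDiff_const (c := q)))
    exact contDiff_const.add (contDiff_const.mul (contDiff_const.sub this))
  have hflux : ∀ x, fluxMap p (gradient β x) = -n⁻¹ • (x - q) := fun x => by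
    rw [hβg, fluxMap_barrier hp hc0, hcp]
  have hwβ : IsWeakDiv (ball q R) (fun x => fluxMap p (gradient β x)) 1 := by
    intro φ hφ
    simp_rw [hflux, inner_smul_left]
    rw [integral_const_mul, integral_inner_sub_gradient hφ.1 hφ.2.1]
    simp only [conj_trivial]
    field_simp
    rfl
  have hcl : closure (ball q R) = closedBall q R := closure_ball q hR.ne'
  have hle : ∀ x ∈ ball q R, β x ≤ y x := fun x hx =>
    le_of_isWeakDiv_fluxMap hp isOpen_ball isBounded_ball hβC.continuous.continuousOn
      (hcl ▸ hy.continuousOn.mono hBW) hβC.contDiffOn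
      (hy.mono (ball_subset_closedBall.trans hBW)) hwβ hwy (fun x hx1 hx2 => by
        rw [hcl] at hx1
        have hd : dist x q = R := le_antisymm hx1 (not_lt.1 hx2)
        refine le_trans (le_of_eq ?_) (hM x hd)
        simp [hβ, ← dist_eq_norm, hd]) hx
  have hzW : z ∈ W := hBW (sphere_subset_closedBall hz)
  have hg : HasDerivAt (fun τ : ℝ => y (z + τ • (q - z))) ⟪gradient y z, q - z⟫ 0 := by
    have h1 := (hasGradientAt_of_contDiffOn hW hy hzW).hasFDerivAt
    have h2 : HasDerivAt (fun τ : ℝ => z + τ • (q - z)) (q - z) 0 := by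
      simpa using ((hasDerivAt_id (0 : ℝ)).smul_const (q - z)).const_add z
    have h3 : HasFDerivAt y ((InnerProductSpace.toDual ℝ E) (gradient y z))
      (z + (0 : ℝ) • (q - z)) := by simpa using h1
    exact h3.comp_hasDerivAt (0 : ℝ) h2
  have hpos : 0 < κ * R ^ p' := by positivity
  refine lt_of_lt_of_le hpos ?_
  have hlim := (hasDerivWithinAt_iff_tendsto_slope' (by simp)).1 (hg.hasDerivWithinAt (s := Ioi 0))
  refine ge_of_tendsto hlim ?_
  filter_upwards [Ioo_mem_nhdsGT (zero_lt_one' ℝ)] with τ hτ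
  have hdist : ‖z - q‖ = R := by rw [← dist_eq_norm]; exact hz
  have hnorm : ‖z + τ • (q - z) - q‖ = (1 - τ) * R := by
    have : z + τ • (q - z) - q = (1 - τ) • (z - q) := by
      rw [sub_smul, one_smul, smul_sub, smul_sub]; abel
    rw [this, norm_smul, Real.norm_of_nonneg (by linarith [hτ.2]), hdist]
  have h1 := hle (z + τ • (q - z)) (by
    rw [mem_ball, dist_eq_norm, hnorm]
    nlinarith [hτ.1])
  simp only [hβ, hnorm] at h1
  rw [Real.mul_rpow (by linarith [hτ.2]) hR.le] at h1
  have h2 : (1 - τ) ^ p' ≤ 1 - τ := by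
    simpa using Real.rpow_le_rpow_of_exponent_ge (by linarith [hτ.2]) (by linarith [hτ.1])
      hp'1.le
  rw [slope_def_field, sub_zero, le_div_iff₀ hτ.1]
  simp only [zero_smul, add_zero, hyz]
  have h3 : 0 < R ^ p' := by positivity
  have h4 := mul_le_mul_of_nonneg_right h2 h3.le
  have h5 : R ^ p' - (1 - τ) ^ p' * R ^ p' ≥ τ * R ^ p' := by linarith
  have h6 := mul_le_mul_of_nonneg_left h5 hκ0.le
  linarith

end Hopf

section UniqueContinuation

variable {E : Type*} [NormedAddCommGroup E] [InnerProductSpace ℝ E] [FiniteDimensional ℝ E]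

lemma HasGradientAt.mul {f g : E → ℝ} {f' g' x : E} (hf : HasGradientAt f f' x)
    (hg : HasGradientAt g g' x) :
    HasGradientAt (fun x => f x * g x) (f x • g' + g x • f') x := by
  rw [hasGradientAt_iff_hasFDerivAt] at *
  rw [map_add, map_smul, map_smul]
  exact HasFDerivAt.fun_mul hf hg

lemma hasGradientAt_sq_mul_inv {η w : E → ℝ} {η' w' x : E} {ε : ℝ} (hη : HasGradientAt η η' x)
    (hw : HasGradientAt w w' x) (h : w x + ε ≠ 0) :
    HasGradientAt (fun x => η x ^ 2 * (w x + ε)⁻¹)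
      ((2 * (η x / (w x + ε))) • η' - (η x / (w x + ε)) ^ 2 • w') x := by
  have h1 : HasGradientAt (fun x => η x ^ 2) ((2 * η x) • η') x := by
    have := HasGradientAt.scomp (hasDerivAt_pow 2 (η x)) hη
    simpa using this
  have hw' : HasGradientAt (fun x => w x + ε) w' x := by
    rw [hasGradientAt_iff_hasFDerivAt] at *
    exact hw.add_const ε
  have h2 := HasGradientAt.scomp (f := fun x => w x + ε) (hasDerivAt_inv h) hw'
  convert HasGradientAt.mul h1 h2 using 1
  rw [smul_smul, smul_smul, sub_eq_add_neg, ← neg_smul, add_comm]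
  congr 2
  · field_simp
  · field_simp

variable [MeasurableSpace E] [BorelSpace E]

lemma exists_log_gradient_bound {z : E} {δ : ℝ} (hδ : 0 < δ) {w : E → ℝ} {F : E → E}
    (hw : ContDiffOn ℝ 1 w (ball z δ)) (hF : ContinuousOn F (ball z δ)) {c C : ℝ} (hc : 0 < c)
    (hC : 0 < C) (h1 : ∀ x ∈ ball z δ, c * ‖gradient w x‖ ^ 2 ≤ ⟪F x, gradient w x⟫)
    (h2 : ∀ x ∈ ball z δ, ‖F x‖ ≤ C * ‖gradient w x‖) (h0 : ∀ x ∈ ball z δ, 0 ≤ w x)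
    (hdiv : IsWeakDiv (ball z δ) F 0) :
    ∃ K : ℝ, ∀ ε > 0, ∃ U : E → ℝ, Continuous U ∧ HasCompactSupport U ∧ (∀ x, 0 ≤ U x) ∧
      (∀ x ∈ ball z (δ / 2), U x = ‖gradient w x‖ / (w x + ε)) ∧ ∫ x, U x ≤ K := by
  let η : ContDiffBump z := ⟨δ / 2, 3 / 4 * δ, by positivity, by linarith⟩
  have hηC : ContDiff ℝ 1 η := η.contDiff
  have hηc : HasCompactSupport η := η.hasCompactSupport
  have hηt : tsupport η = closedBall z (3 / 4 * δ) := η.tsupport_eq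
  have hηB : tsupport η ⊆ ball z δ := by
    rw [hηt]; exact closedBall_subset_ball (by linarith)
  have hη' : IsC1Test univ η := ⟨hηC, hηc, subset_univ _⟩
  have hi1 : Integrable (fun x => ‖gradient η x‖ ^ 2) := by
    have := hη'.integrable_inner isOpen_univ (continuous_gradient hηC).continuousOn
    simpa only [real_inner_self_eq_norm_sq] using this
  have hi2 : Integrable ((closedBall z (3 / 4 * δ)).indicator (fun _ => c / 2)) :=
    (integrable_indicator_iff measurableSet_closedBall).2
      (integrableOn_const (measure_closedBall_lt_top.ne) )
  set K0 := ∫ x, ((closedBall z (3 / 4 * δ)).indicator (fun _ => c / 2) x +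
    2 * C ^ 2 / c * ‖gradient η x‖ ^ 2) with hK0
  refine ⟨c⁻¹ * K0, fun ε hε => ?_⟩
  set U : E → ℝ := fun x => η x * (‖gradient w x‖ / (w x + ε)) with hU
  have hUt : tsupport U ⊆ tsupport η := tsupport_mul_subset_left
  have hUcont : Continuous U := by
    refine continuous_of_tsupport fun x hx => ?_
    have hxB := hηB (hUt hx)
    have hn := isOpen_ball.mem_nhds hxB
    exact hηC.continuous.continuousAt.mul
      (((continuousOn_gradient isOpen_ball hw).continuousAt hn).norm.div
        ((hw.continuousOn.continuousAt hn).add continuousAt_const)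
        (by linarith [h0 x hxB]))
  have hUcomp : HasCompactSupport U := hηc.mul_right
  have hUint : Integrable U := hUcont.integrable_of_hasCompactSupport hUcomp
  have hUnn : ∀ x, 0 ≤ U x := by
    intro x
    by_cases hx : x ∈ tsupport η
    · have := h0 x (hηB hx)
      have := η.nonneg' x
      simp only [hU]
      positivity
    · simp [hU, image_eq_zero_of_notMem_tsupport hx]
  refine ⟨U, hUcont, hUcomp, hUnn, fun x hx => ?_, ?_⟩
  · simp [hU, η.one_of_mem_closedBall (ball_subset_closedBall hx)]
  set φ : E → ℝ := fun x => η x ^ 2 * (w x + ε)⁻¹ with hφ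
  have hφt : tsupport φ ⊆ tsupport η := by
    refine tsupport_mul_subset_left.trans (closure_mono ?_)
    exact fun x hx h => hx (by simp [h])
  have hφT : IsC1Test (ball z δ) φ := by
    refine ⟨contDiff_of_contDiffAt_tsupport fun x hx => ?_, hηc.mono' (subset_closure.trans hφt),
      hφt.trans hηB⟩
    have hxB := hηB (hφt hx)
    exact (hηC.contDiffAt.pow 2).mul (((hw.contDiffAt (isOpen_ball.mem_nhds hxB)).add
      contDiffAt_const).inv (by linarith [h0 x hxB]))
  have hinteg := hdiv φ hφT
  rw [zero_mul] at hinteg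
  have hpt : ∀ x, ⟪F x, gradient φ x⟫ ≤ ((closedBall z (3 / 4 * δ)).indicator (fun _ => c / 2) x +
      2 * C ^ 2 / c * ‖gradient η x‖ ^ 2) - c * U x := by
    intro x
    by_cases hx : x ∈ tsupport η
    · have hxB := hηB hx
      have hwx := h0 x hxB
      have hg := (hasGradientAt_sq_mul_inv (ε := ε)
        ((hηC.differentiable one_ne_zero x).hasGradientAt)
        (hasGradientAt_of_contDiffOn isOpen_ball hw hxB) (by linarith)).gradient
      rw [hφ, hg, inner_sub_right, inner_smul_right, inner_smul_right,
        indicator_of_mem (hηt ▸ hx)]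
      set t := η x / (w x + ε) with ht
      have ht0 : 0 ≤ t := div_nonneg (η.nonneg' x) (by linarith)
      have hUx : U x = t * ‖gradient w x‖ := by simp only [hU, ht]; ring
      have b1 : ⟪F x, gradient η x⟫ ≤ C * ‖gradient w x‖ * ‖gradient η x‖ :=
        (real_inner_le_norm _ _).trans (mul_le_mul_of_nonneg_right (h2 x hxB) (norm_nonneg _))
      have b2 := mul_le_mul_of_nonneg_left b1 (by positivity : 0 ≤ 2 * t)
      have b3 := mul_le_mul_of_nonneg_left (h1 x hxB) (sq_nonneg t)
      have b4 : 2 * t * (C * ‖gradient w x‖ * ‖gradient η x‖) - t ^ 2 * (c * ‖gradient w x‖ ^ 2) =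
        2 * C * ‖gradient η x‖ * U x - c * U x ^ 2 := by rw [hUx]; ring
      have b5 : 2 * C * ‖gradient η x‖ * U x ≤
          2 * C ^ 2 / c * ‖gradient η x‖ ^ 2 + c / 2 * U x ^ 2 := by
        have : 2 * C ^ 2 / c * ‖gradient η x‖ ^ 2 + c / 2 * U x ^ 2 -
          2 * C * ‖gradient η x‖ * U x = (2 * C * ‖gradient η x‖ - c * U x) ^ 2 / (2 * c) := by
          field_simp
          ring
        have h' : 0 ≤ (2 * C * ‖gradient η x‖ - c * U x) ^ 2 / (2 * c) := by positivity
        linarith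
      nlinarith [mul_nonneg hc.le (sq_nonneg (U x - 1))]
    · have e1 : gradient φ x = 0 := gradient_eq_zero_of_notMem_tsupport fun h => hx (hφt h)
      have e2 : U x = 0 := by simp [hU, image_eq_zero_of_notMem_tsupport hx]
      rw [e1, e2, inner_zero_right, mul_zero, sub_zero]
      refine add_nonneg (indicator_nonneg (fun _ _ => by positivity) _) (by positivity)
  have hmono := integral_mono (hφT.integrable_inner isOpen_ball hF)
    ((hi2.add (hi1.const_mul (2 * C ^ 2 / c))).sub (hUint.const_mul c)) hpt
  have e3 := integral_sub (hi2.add (hi1.const_mul (2 * C ^ 2 / c))) (hUint.const_mul c)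
  simp only [Pi.add_apply, Pi.sub_apply] at e3 hmono
  rw [hinteg, e3, integral_const_mul, ← hK0] at hmono
  rw [inv_mul_eq_div, le_div_iff₀ hc]
  linarith

/-- A nonnegative weak solution of a uniformly elliptic equation which vanishes near a point
vanishes nearby. -/
lemma eq_zero_of_isWeakDiv_of_eventuallyEq {z : E} {δ : ℝ} {w : E → ℝ}
    {F : E → E} (hw : ContDiffOn ℝ 1 w (ball z δ)) (hF : ContinuousOn F (ball z δ)) {c C : ℝ}
    (hc : 0 < c) (hC : 0 < C)
    (h1 : ∀ x ∈ ball z δ, c * ‖gradient w x‖ ^ 2 ≤ ⟪F x, gradient w x⟫)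
    (h2 : ∀ x ∈ ball z δ, ‖F x‖ ≤ C * ‖gradient w x‖) (h0 : ∀ x ∈ ball z δ, 0 ≤ w x)
    (hdiv : IsWeakDiv (ball z δ) F 0) {q : E} (hq : q ∈ ball z (δ / 2))
    (hwq : ∀ᶠ x in nhds q, w x = 0) {a : E} (ha : a ∈ ball z (δ / 2)) : w a = 0 := by
  have hδ : 0 < δ := by
    have := (dist_nonneg (x := q) (y := z)).trans_lt hq
    linarith
  obtain ⟨K, hK⟩ := exists_log_gradient_bound hδ hw hF hc hC h1 h2 h0 hdiv
  have hsub : ball z (δ / 2) ⊆ ball z δ := ball_subset_ball (by linarith)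
  by_contra hne
  have hpos : 0 < w a := lt_of_le_of_ne (h0 a (hsub ha)) (Ne.symm hne)
  set m := w a / 2 with hm
  have hm0 : 0 < m := by positivity
  have hwa : ∀ᶠ x in nhds a, m < w x :=
    (hw.continuousOn.continuousAt (isOpen_ball.mem_nhds (hsub ha))).eventually
      (lt_mem_nhds (by linarith))
  obtain ⟨r1, hr1, hq1⟩ := Metric.eventually_nhds_iff_ball.1
    (hwq.and (isOpen_ball.mem_nhds hq))
  obtain ⟨r2, hr2, ha1⟩ := Metric.eventually_nhds_iff_ball.1
    (hwa.and (isOpen_ball.mem_nhds ha))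
  set r := min r1 r2 with hr
  have hr0 : 0 < r := lt_min hr1 hr2
  set h := a - q with hh
  have hqξ : ∀ ξ ∈ ball (0 : E) r, q + ξ ∈ ball q r1 := fun ξ hξ => by
    rw [mem_ball_zero_iff] at hξ
    simpa using hξ.trans_le (min_le_left _ _)
  have haξ : ∀ ξ ∈ ball (0 : E) r, a + ξ ∈ ball a r2 := fun ξ hξ => by
    rw [mem_ball_zero_iff] at hξ
    simpa using hξ.trans_le (min_le_right _ _)
  have hseg : ∀ ξ ∈ ball (0 : E) r, ∀ τ ∈ Icc (0 : ℝ) 1, q + ξ + τ • h ∈ ball z (δ / 2) := by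
    intro ξ hξ τ hτ
    have := (convex_ball z (δ / 2)) (hq1 _ (hqξ ξ hξ)).2 (ha1 _ (haξ ξ hξ)).2
      (sub_nonneg.2 hτ.2) hτ.1 (by ring)
    convert this using 1
    rw [hh]
    module
  set V := volume.real (ball (0 : E) r) with hV
  have hV0 : 0 < V := ENNReal.toReal_pos (measure_ball_pos volume _ hr0).ne'
    measure_ball_lt_top.ne
  have key : ∀ ε > 0, V * Real.log ((m + ε) / ε) ≤ ‖h‖ * K := by
    intro ε hε
    obtain ⟨U, hUc, hUs, hU0, hUe, hUK⟩ := hK ε hε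
    have hline : ∀ ξ ∈ ball (0 : E) r,
        Real.log ((m + ε) / ε) ≤ ‖h‖ * ∫ τ in Ioc (0 : ℝ) 1, U (q + ξ + τ • h) := by
      intro ξ hξ
      have hγ : ∀ τ : ℝ, HasDerivAt (fun τ : ℝ => q + ξ + τ • h) h τ := fun τ => by
        simpa using ((hasDerivAt_id τ).smul_const h).const_add (q + ξ)
      have hd : ∀ τ ∈ Icc (0 : ℝ) 1, HasDerivAt (fun τ : ℝ => Real.log (w (q + ξ + τ • h) + ε))
          (⟪gradient w (q + ξ + τ • h), h⟫ / (w (q + ξ + τ • h) + ε)) τ := by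
        intro τ hτ
        have hx := hsub (hseg ξ hξ τ hτ)
        have h3 := (hasGradientAt_of_contDiffOn isOpen_ball hw hx).hasFDerivAt
        have h4 : HasDerivAt (fun τ : ℝ => w (q + ξ + τ • h)) ⟪gradient w (q + ξ + τ • h), h⟫ τ :=
          HasFDerivAt.comp_hasDerivAt (f := fun τ : ℝ => q + ξ + τ • h) τ h3 (hγ τ)
        exact (h4.add_const ε).log (by linarith [h0 _ hx])
      have hUi : Continuous (fun τ : ℝ => ‖h‖ * U (q + ξ + τ • h)) := by fun_prop
      have := intervalIntegral.sub_le_integral_of_hasDeriv_right_of_le zero_le_one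
        (fun τ hτ => (hd τ hτ).continuousAt.continuousWithinAt)
        (fun τ hτ => (hd τ (Ioo_subset_Icc_self hτ)).hasDerivWithinAt)
        (φ := fun τ => ‖h‖ * U (q + ξ + τ • h)) hUi.integrableOn_Icc
        (fun τ hτ => by
          have hx := hseg ξ hξ τ (Ioo_subset_Icc_self hτ)
          have hw0 := h0 _ (hsub hx)
          rw [hUe _ hx, mul_div_assoc']
          refine div_le_div_of_nonneg_right ?_ (by linarith)
          rw [mul_comm]
          exact real_inner_le_norm _ _)
      rw [intervalIntegral.integral_of_le zero_le_one, integral_const_mul] at this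
      refine le_trans ?_ this
      have e1 : q + ξ + (1 : ℝ) • h = a + ξ := by rw [hh, one_smul]; abel
      rw [zero_smul, add_zero, e1, (hq1 _ (hqξ ξ hξ)).1, zero_add,
        Real.log_div (by positivity) hε.ne']
      have := Real.log_le_log (by positivity)
        (add_le_add_left (ha1 _ (haξ ξ hξ)).1.le ε)
      linarith
    obtain ⟨B, hB⟩ := hUs.exists_bound_of_continuous hUc
    have hjc : Continuous (fun P : E × ℝ => U (q + P.1 + P.2 • h)) := by fun_prop
    have hprod : Integrable (Function.uncurry fun (ξ : E) (τ : ℝ) => U (q + ξ + τ • h))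
        ((volume.restrict (ball (0 : E) r)).prod (volume.restrict (Ioc (0 : ℝ) 1))) := by
      have : IsFiniteMeasure (volume.restrict (ball (0 : E) r)) :=
        ⟨by rw [Measure.restrict_apply_univ]; exact measure_ball_lt_top⟩
      refine Integrable.of_bound hjc.aestronglyMeasurable B (.of_forall fun P => hB _)
    have hUint : Integrable U := hUc.integrable_of_hasCompactSupport hUs
    have hin : ∀ τ : ℝ, ∫ ξ in ball (0 : E) r, U (q + ξ + τ • h) ≤ K := by
      intro τ
      have e : ∀ ξ, q + ξ + τ • h = ξ + (q + τ • h) := fun ξ => by abel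
      simp_rw [e]
      refine le_trans (setIntegral_le_integral (hUint.comp_add_right _)
        (.of_forall fun ξ => hU0 _)) ?_
      rw [integral_add_right_eq_self]
      exact hUK
    calc V * Real.log ((m + ε) / ε) = ∫ ξ in ball (0 : E) r, Real.log ((m + ε) / ε) := by
          rw [setIntegral_const, smul_eq_mul]
      _ ≤ ∫ ξ in ball (0 : E) r, ‖h‖ * ∫ τ in Ioc (0 : ℝ) 1, U (q + ξ + τ • h) := by
          refine setIntegral_mono_on (integrableOn_const measure_ball_lt_top.ne)
            (hprod.integral_prod_left.const_mul _) measurableSet_ball hline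
      _ = ‖h‖ * ∫ τ in Ioc (0 : ℝ) 1, ∫ ξ in ball (0 : E) r, U (q + ξ + τ • h) := by
          rw [integral_const_mul, integral_integral_swap hprod]
      _ ≤ ‖h‖ * ∫ τ in Ioc (0 : ℝ) 1, K := by
          refine mul_le_mul_of_nonneg_left ?_ (norm_nonneg _)
          exact setIntegral_mono_on hprod.integral_prod_right (integrableOn_const (by simp))
            measurableSet_Ioc fun τ _ => hin τ
      _ = ‖h‖ * K := by simp
  set t := ‖h‖ * K / V + 1 with ht
  have hkt := key (m * Real.exp (-t)) (by positivity)
  have hle : t ≤ Real.log ((m + m * Real.exp (-t)) / (m * Real.exp (-t))) := by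
    rw [Real.le_log_iff_exp_le (by positivity), le_div_iff₀ (by positivity)]
    have : Real.exp t * (m * Real.exp (-t)) = m := by
      rw [mul_left_comm, ← Real.exp_add]; simp
    rw [this]
    have : 0 < m * Real.exp (-t) := by positivity
    linarith
  have h3 := mul_le_mul_of_nonneg_left hle hV0.le
  have h4 : V * t = ‖h‖ * K + V := by rw [ht]; field_simp
  linarith

end UniqueContinuation

section Cutoff

variable {E : Type*} [NormedAddCommGroup E] [InnerProductSpace ℝ E]

/-- Radial cutoff vanishing near the ball of radius `r` and centre `c`. -/
def radialCutoff (c : E) (r k : ℝ) (x : E) : ℝ :=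
  Real.smoothTransition (k * (‖x - c‖ ^ 2 - r ^ 2) - 1)

lemma contDiff_radialCutoff (c : E) (r k : ℝ) : ContDiff ℝ 1 (radialCutoff c r k) := by
  have h : ContDiff ℝ 1 fun x : E => ‖x - c‖ ^ 2 := (contDiff_id.sub contDiff_const).norm_sq ℝ
  exact Real.smoothTransition.contDiff.comp
    ((contDiff_const.mul (h.sub contDiff_const)).sub contDiff_const)

/-- The derivative of the profile of `radialCutoff`. -/
def radialCutoffDeriv (c : E) (r k : ℝ) (x : E) : ℝ :=
  deriv Real.smoothTransition (k * (‖x - c‖ ^ 2 - r ^ 2) - 1) * (2 * k)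

omit [InnerProductSpace ℝ E] in
lemma radialCutoffDeriv_nonneg (c : E) (r : ℝ) {k : ℝ} (hk : 0 ≤ k) (x : E) :
    0 ≤ radialCutoffDeriv c r k x :=
  mul_nonneg Real.smoothTransition.monotone.deriv_nonneg (by positivity)

lemma deriv_smoothTransition_eq_zero {t : ℝ} (ht : t < 0 ∨ 1 < t) :
    deriv Real.smoothTransition t = 0 := by
  rcases ht with ht | ht
  · have : Real.smoothTransition =ᶠ[nhds t] fun _ => (0 : ℝ) := by
      filter_upwards [Iio_mem_nhds ht] with s hs
      exact Real.smoothTransition.zero_of_nonpos (le_of_lt hs)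
    rw [this.deriv_eq, deriv_const]
  · have : Real.smoothTransition =ᶠ[nhds t] fun _ => (1 : ℝ) := by
      filter_upwards [Ioi_mem_nhds ht] with s hs
      exact Real.smoothTransition.one_of_one_le (le_of_lt hs)
    rw [this.deriv_eq, deriv_const]

omit [InnerProductSpace ℝ E] in
lemma mem_shell_of_radialCutoffDeriv_ne_zero {c x : E} {r k : ℝ} (hk : 0 < k)
    (hx : radialCutoffDeriv c r k x ≠ 0) :
    r ^ 2 ≤ ‖x - c‖ ^ 2 ∧ ‖x - c‖ ^ 2 ≤ r ^ 2 + 2 / k := by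
  have h : ¬ (k * (‖x - c‖ ^ 2 - r ^ 2) - 1 < 0 ∨ 1 < k * (‖x - c‖ ^ 2 - r ^ 2) - 1) :=
    fun h => hx (by rw [radialCutoffDeriv, deriv_smoothTransition_eq_zero h, zero_mul])
  push Not at h
  constructor
  · by_contra! hlt
    nlinarith
  · have : k * (‖x - c‖ ^ 2 - r ^ 2) ≤ 2 := by linarith
    have := (le_div_iff₀' hk).2 this
    linarith

variable [FiniteDimensional ℝ E]

lemma hasGradientAt_radialCutoff (c : E) (r k : ℝ) (x : E) :
    HasGradientAt (radialCutoff c r k) (radialCutoffDeriv c r k x • (x - c)) x := by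
  have h1 : HasGradientAt (fun x : E => k * (‖x - c‖ ^ 2 - r ^ 2) - 1) ((2 * k) • (x - c)) x := by
    rw [hasGradientAt_iff_hasFDerivAt]
    have := ((((hasFDerivAt_id x).sub_const c).norm_sq.sub_const (r ^ 2)).const_mul k).sub_const 1
    refine this.congr_fderiv ?_
    ext z
    simp
    ring
  have h2 := HasGradientAt.scomp (f := fun x : E => k * (‖x - c‖ ^ 2 - r ^ 2) - 1)
    (((Real.smoothTransition.contDiff (n := 1)).differentiable one_ne_zero _).hasDerivAt) h1
  rw [smul_smul] at h2
  exact h2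

variable [MeasurableSpace E] [BorelSpace E]

lemma isWeakDiv_of_isWeakDiv_diff_closedBall {O : Set E} (hO : IsOpen O) {F : E → E}
    (hF : ContinuousOn F O) {c : E} {r : ℝ} (hr : 0 < r)
    (hF0 : ∀ x ∈ O, ‖x - c‖ ≤ r → F x = 0)
    (hw : IsWeakDiv (O ∩ {x | r < ‖x - c‖}) F 0) : IsWeakDiv O F 0 := by
  intro φ hφ
  rw [zero_mul]
  have hdφ : ∀ x, HasGradientAt φ (gradient φ x) x := fun x =>
    (hφ.1.differentiable one_ne_zero x).hasGradientAt
  have hχC := contDiff_radialCutoff c r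
  have hχ0 : ∀ k x, 0 ≤ radialCutoff c r k x := fun k x => Real.smoothTransition.nonneg _
  have hχ1 : ∀ k x, radialCutoff c r k x ≤ 1 := fun k x => Real.smoothTransition.le_one _
  have hgr : ∀ k x, gradient (radialCutoff c r k) x = radialCutoffDeriv c r k x • (x - c) :=
    fun k x => (hasGradientAt_radialCutoff c r k x).gradient
  obtain ⟨R, hR0, hR⟩ : ∃ R : ℝ, 0 < R ∧ tsupport φ ⊆ closedBall c R := by
    obtain ⟨R, hR⟩ := hφ.2.1.isCompact.isBounded.subset_closedBall c
    exact ⟨max R 1, by positivity, hR.trans (closedBall_subset_closedBall (le_max_left _ _))⟩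
  let ψ : ContDiffBump c := ⟨R, R + 1, hR0, by linarith⟩
  have hψC : ContDiff ℝ 1 ψ := ψ.contDiff
  have hψc : HasCompactSupport ψ := ψ.hasCompactSupport
  have hψT : IsC1Test univ ψ := ⟨hψC, hψc, subset_univ _⟩
  have hdψ : ∀ x, HasGradientAt ψ (gradient ψ x) x := fun x =>
    (hψC.differentiable one_ne_zero x).hasGradientAt
  have hlin : ContinuousOn (fun x : E => x - c) univ := by fun_prop
  have hIψ : Integrable (fun x => ⟪x - c, gradient ψ x⟫) :=
    hψT.integrable_inner isOpen_univ hlin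
  set B := ∫ x, |⟪x - c, gradient ψ x⟫| with hB
  have hB0 : 0 ≤ B := integral_nonneg fun _ => abs_nonneg _
  have hcc : ∀ k, Continuous (radialCutoffDeriv c r k) := fun k => by
    have hc : Continuous (deriv Real.smoothTransition) :=
      (Real.smoothTransition.contDiff (n := 1)).continuous_deriv le_rfl
    unfold radialCutoffDeriv
    exact (hc.comp (by fun_prop)).mul continuous_const
  have hIg : ∀ k, Integrable (fun x => ψ x * (radialCutoffDeriv c r k x * ‖x - c‖ ^ 2)) :=
    fun k => (hψC.continuous.mul ((hcc k).mul (by fun_prop))).integrable_of_hasCompactSupport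
      hψc.mul_right
  have hbound : ∀ k, ∫ x, ψ x * (radialCutoffDeriv c r k x * ‖x - c‖ ^ 2) ≤ B := by
    intro k
    have h1 := integral_inner_sub_gradient (hψC.mul (hχC k)) (hψc.mul_right) c
    have hg : ∀ x, gradient (fun x => ψ x * radialCutoff c r k x) x =
        ψ x • radialCutoffDeriv c r k x • (x - c) + radialCutoff c r k x • gradient ψ x :=
      fun x => (HasGradientAt.mul (hdψ x) (hasGradientAt_radialCutoff c r k x)).gradient
    have hI2 : Integrable (fun x => radialCutoff c r k x * ⟪x - c, gradient ψ x⟫) :=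
      ((hχC k).continuous.mul (hψT.continuous_inner isOpen_univ hlin)).integrable_of_hasCompactSupport
        ((hψc.mono' ((subset_tsupport _).trans (tsupport_inner_gradient_subset _ _))).mul_left)
    have h2 : ∀ x, ⟪x - c, gradient (fun x => ψ x * radialCutoff c r k x) x⟫ =
        ψ x * (radialCutoffDeriv c r k x * ‖x - c‖ ^ 2) +
          radialCutoff c r k x * ⟪x - c, gradient ψ x⟫ := fun x => by
      rw [hg, inner_add_right, inner_smul_right, inner_smul_right, inner_smul_right,
        real_inner_self_eq_norm_sq]
    simp_rw [h2] at h1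
    rw [integral_add (hIg k) hI2] at h1
    have h3 : 0 ≤ ∫ x, ψ x * radialCutoff c r k x :=
      integral_nonneg fun x => mul_nonneg (ψ.nonneg' x) (hχ0 k x)
    have h4 : -B ≤ ∫ x, radialCutoff c r k x * ⟪x - c, gradient ψ x⟫ := by
      rw [hB, ← integral_neg]
      refine integral_mono hIψ.abs.neg hI2 fun x => ?_
      have := neg_abs_le ⟪x - c, gradient ψ x⟫
      have h5 := abs_nonneg ⟪x - c, gradient ψ x⟫
      have := mul_le_mul_of_nonneg_left this (hχ0 k x)
      have := mul_le_mul_of_nonneg_right (hχ1 k x) h5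
      simp only
      linarith
    have h5 : 0 ≤ (Module.finrank ℝ E : ℝ) * ∫ x, ψ x * radialCutoff c r k x := by positivity
    linarith
  set Φ : E → E := fun x => φ x • F x with hΦ
  have hΦt : tsupport Φ ⊆ tsupport φ := closure_mono fun x hx h => hx (by simp [hΦ, h])
  have hΦc : Continuous Φ := continuous_of_tsupport fun x hx =>
    hφ.1.continuous.continuousAt.smul (hF.continuousAt (hO.mem_nhds (hφ.2.2 (hΦt hx))))
  have hΦs : HasCompactSupport Φ := hφ.2.1.mono' (subset_closure.trans hΦt)
  have hΦ0 : ∀ x, ‖x - c‖ ≤ r → Φ x = 0 := fun x hx => by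
    by_cases hxO : x ∈ O
    · simp [hΦ, hF0 x hxO hx]
    · simp [hΦ, image_eq_zero_of_notMem_tsupport fun h => hxO (hφ.2.2 h)]
  have huc := hΦs.uniformContinuous_of_continuous hΦc
  have hχφ : ∀ k > 0, IsC1Test (O ∩ {x | r < ‖x - c‖}) (fun x => radialCutoff c r k x * φ x) := by
    intro k hk
    refine ⟨(hχC k).mul hφ.1, hφ.2.1.mul_left, fun x hx => ⟨hφ.2.2
      (tsupport_mul_subset_right hx), ?_⟩⟩
    have hcl : IsClosed {x : E | 0 ≤ k * (‖x - c‖ ^ 2 - r ^ 2) - 1} :=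
      isClosed_le continuous_const (by fun_prop)
    have : 0 ≤ k * (‖x - c‖ ^ 2 - r ^ 2) - 1 := by
      refine closure_minimal (fun z hz => ?_) hcl (tsupport_mul_subset_left hx)
      by_contra hlt
      exact hz (Real.smoothTransition.zero_of_nonpos (not_le.1 hlt).le)
    have h2 : 0 < ‖x - c‖ ^ 2 - r ^ 2 := by
      by_contra! h'
      nlinarith
    exact lt_of_pow_lt_pow_left₀ 2 (norm_nonneg _) (by linarith)
  have hIF := hφ.integrable_inner hO hF
  have hcF := hφ.continuous_inner hO hF
  have hsmall : Filter.Tendsto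
      (fun k : ℕ => ∫ x, radialCutoff c r (k + 1 : ℝ) x * ⟪F x, gradient φ x⟫)
      Filter.atTop (nhds 0) := by
    rw [Metric.tendsto_atTop]
    intro ε hε
    set ε' := ε * r / (2 * (B + 1)) with hε'
    have hε'0 : 0 < ε' := by positivity
    obtain ⟨d, hd, hd'⟩ := Metric.uniformContinuous_iff.1 huc ε' hε'0
    obtain ⟨n, hn⟩ := exists_nat_gt (2 / (d * r))
    refine ⟨n, fun k hk => ?_⟩
    set κ : ℝ := k + 1 with hκ
    have hκ0 : 0 < κ := by positivity
    have hκd : 2 / κ < d * r := by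
      have hkn : (n : ℝ) ≤ k := by exact_mod_cast hk
      have hh : 2 / (d * r) < κ := by rw [hκ]; linarith
      rw [div_lt_iff₀ (by positivity)] at hh ⊢
      linarith
    have hdiv := hw _ (hχφ κ hκ0)
    have hg : ∀ x, gradient (fun x => radialCutoff c r κ x * φ x) x =
        radialCutoff c r κ x • gradient φ x + φ x • radialCutoffDeriv c r κ x • (x - c) :=
      fun x => (HasGradientAt.mul (hasGradientAt_radialCutoff c r κ x) (hdφ x)).gradient
    have h2 : ∀ x, ⟪F x, gradient (fun x => radialCutoff c r κ x * φ x) x⟫ =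
        radialCutoff c r κ x * ⟪F x, gradient φ x⟫ +
          radialCutoffDeriv c r κ x * ⟪Φ x, x - c⟫ := fun x => by
      rw [hg, inner_add_right, inner_smul_right, inner_smul_right, inner_smul_right, hΦ,
        real_inner_smul_left]
      ring
    have hI1 : Integrable (fun x => radialCutoff c r κ x * ⟪F x, gradient φ x⟫) :=
      ((hχC κ).continuous.mul hcF).integrable_of_hasCompactSupport
        ((hφ.2.1.mono' ((subset_tsupport _).trans (tsupport_inner_gradient_subset _ _))).mul_left)
    have hI2 : Integrable (fun x => radialCutoffDeriv c r κ x * ⟪Φ x, x - c⟫) :=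
      ((hcc κ).mul (hΦc.inner (by fun_prop))).integrable_of_hasCompactSupport
        (hΦs.mono' fun x hx => subset_tsupport _ fun h => hx (by simp [h]))
    simp_rw [h2] at hdiv
    rw [integral_add hI1 hI2, zero_mul] at hdiv
    have hpt : ∀ x, |radialCutoffDeriv c r κ x * ⟪Φ x, x - c⟫| ≤
        ε' / r * (ψ x * (radialCutoffDeriv c r κ x * ‖x - c‖ ^ 2)) := by
      intro x
      have hnn := radialCutoffDeriv_nonneg c r hκ0.le x
      by_cases hgx : radialCutoffDeriv c r κ x = 0
      · simp [hgx]
      by_cases hφx : φ x = 0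
      · have : Φ x = 0 := by simp [hΦ, hφx]
        rw [this, inner_zero_left, mul_zero, abs_zero]
        have := ψ.nonneg' x
        positivity
      have hψx : ψ x = 1 := ψ.one_of_mem_closedBall (hR (subset_tsupport _ hφx))
      obtain ⟨hs1, hs2⟩ := mem_shell_of_radialCutoffDeriv_ne_zero hκ0 hgx
      have hrx : r ≤ ‖x - c‖ := le_of_sq_le_sq hs1 (norm_nonneg _)
      have hx0 : 0 < ‖x - c‖ := hr.trans_le hrx
      have hxd : ‖x - c‖ - r < d := by
        have h5 : (‖x - c‖ - r) * r ≤ ‖x - c‖ ^ 2 - r ^ 2 := by nlinarith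
        by_contra! h6
        nlinarith
      have hΦx : ‖Φ x‖ ≤ ε' := by
        set x0 := c + (r / ‖x - c‖) • (x - c) with hx0'
        have e0 : Φ x0 = 0 := hΦ0 x0 (by
          rw [hx0', add_sub_cancel_left, norm_smul, Real.norm_of_nonneg (by positivity),
            div_mul_cancel₀ _ hx0.ne'])
        have e1 : dist x x0 < d := by
          have : x - x0 = (1 - r / ‖x - c‖) • (x - c) := by rw [hx0']; module
          rw [dist_eq_norm, this, norm_smul, Real.norm_of_nonneg (by
            rw [sub_nonneg, div_le_one hx0]; exact hrx), sub_mul, one_mul,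
            div_mul_cancel₀ _ hx0.ne']
          exact hxd
        have := (hd' e1).le
        rwa [e0, dist_zero_right] at this
      rw [abs_mul, abs_of_nonneg hnn, hψx, one_mul]
      have h7 : |⟪Φ x, x - c⟫| ≤ ε' * ‖x - c‖ :=
        (abs_real_inner_le_norm _ _).trans (mul_le_mul_of_nonneg_right hΦx hx0.le)
      have h8 : ε' * ‖x - c‖ ≤ ε' / r * ‖x - c‖ ^ 2 := by
        rw [div_mul_eq_mul_div ε' r, le_div_iff₀ hr]
        have := mul_le_mul_of_nonneg_left hrx (by positivity : 0 ≤ ε' * ‖x - c‖)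
        nlinarith
      calc _ ≤ radialCutoffDeriv c r κ x * (ε' / r * ‖x - c‖ ^ 2) :=
            mul_le_mul_of_nonneg_left (h7.trans h8) hnn
        _ = _ := by ring
    have h9 : |∫ x, radialCutoffDeriv c r κ x * ⟪Φ x, x - c⟫| ≤ ε' / r * B := by
      refine abs_integral_le_integral_abs.trans ((integral_mono hI2.abs
        ((hIg κ).const_mul _) hpt).trans ?_)
      rw [integral_const_mul]
      exact mul_le_mul_of_nonneg_left (hbound κ) (by positivity)
    rw [dist_zero_right, Real.norm_eq_abs, eq_neg_of_add_eq_zero_left hdiv, abs_neg]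
    refine h9.trans_lt ?_
    have : ε' / r * B = ε * (B / (2 * (B + 1))) := by rw [hε']; field_simp
    rw [this]
    have : B / (2 * (B + 1)) < 1 := by
      rw [div_lt_one (by positivity)]; linarith
    nlinarith
  refine tendsto_nhds_unique ?_ hsmall
  refine tendsto_integral_of_dominated_convergence (fun x => |⟪F x, gradient φ x⟫|)
    (fun k => ((hχC _).continuous.mul hcF).aestronglyMeasurable) hIF.abs
    (fun k => .of_forall fun x => ?_) (.of_forall fun x => ?_)
  · rw [norm_mul, Real.norm_of_nonneg (hχ0 _ _), Real.norm_eq_abs]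
    exact mul_le_of_le_one_left (abs_nonneg _) (hχ1 _ _)
  · by_cases hx : r < ‖x - c‖
    · have hpos : 0 < ‖x - c‖ ^ 2 - r ^ 2 := by nlinarith
      refine tendsto_const_nhds.congr' ?_
      obtain ⟨n, hn⟩ := exists_nat_gt (2 / (‖x - c‖ ^ 2 - r ^ 2))
      filter_upwards [Filter.eventually_ge_atTop n] with k hk
      have hkn : (n : ℝ) ≤ k := by exact_mod_cast hk
      have : radialCutoff c r (k + 1 : ℝ) x = 1 := by
        refine Real.smoothTransition.one_of_one_le ?_
        have h3 : 2 / (‖x - c‖ ^ 2 - r ^ 2) < (k + 1 : ℝ) := by linarith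
        rw [div_lt_iff₀ hpos] at h3
        linarith
      rw [this, one_mul]
    · have : ⟪F x, gradient φ x⟫ = 0 := by
        by_cases hxO : x ∈ O
        · rw [hF0 x hxO (not_lt.1 hx), inner_zero_left]
        · rw [gradient_eq_zero_of_notMem_tsupport fun h => hxO (hφ.2.2 h), inner_zero_right]
      simp [this]

end Cutoff

section Touching

variable {E : Type*} [NormedAddCommGroup E] [InnerProductSpace ℝ E]

omit [InnerProductSpace ℝ E] in
lemma continuousOn_ite_norm {G : Type*} [NormedAddCommGroup G] {O : Set E} (hO : IsOpen O)
    {f : E → G} (hf : ContinuousOn f O) {c : E} {r : ℝ} (h0 : ∀ x ∈ O, ‖x - c‖ = r → f x = 0) :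
    ContinuousOn (fun x => if r < ‖x - c‖ then f x else 0) O := by
  intro x hx
  refine ContinuousAt.continuousWithinAt ?_
  have hfx := hf.continuousAt (hO.mem_nhds hx)
  have hc : Continuous fun x : E => ‖x - c‖ := by fun_prop
  rcases lt_trichotomy r ‖x - c‖ with h | h | h
  · refine hfx.congr ?_
    filter_upwards [hc.continuousAt.eventually (lt_mem_nhds h)] with x' hx'
    rw [if_pos hx']
  · have hfx0 := h0 x hx h.symm
    rw [ContinuousAt, hfx0] at hfx
    rw [ContinuousAt, if_neg h.not_lt]
    refine squeeze_zero_norm (fun x' => ?_) (tendsto_zero_iff_norm_tendsto_zero.1 hfx)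
    split_ifs
    · exact le_rfl
    · simp
  · refine (continuousAt_const (y := (0 : G))).congr ?_
    filter_upwards [hc.continuousAt.eventually (gt_mem_nhds h)] with x' hx'
    rw [if_neg (lt_asymm hx')]

variable [FiniteDimensional ℝ E]

lemma contDiffOn_one_of_hasGradientAt {O : Set E} (hO : IsOpen O) {f : E → ℝ} {G : E → E}
    (hG : ContinuousOn G O) (h : ∀ x ∈ O, HasGradientAt f (G x) x) : ContDiffOn ℝ 1 f O := by
  rw [← zero_add (1 : WithTop ℕ∞), contDiffOn_succ_iff_fderiv_of_isOpen hO, contDiffOn_zero]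
  refine ⟨fun x hx => (h x hx).hasFDerivAt.differentiableAt.differentiableWithinAt, by simp, ?_⟩
  refine ((InnerProductSpace.toDual ℝ E).continuous.comp_continuousOn hG).congr fun x hx => ?_
  exact (h x hx).hasFDerivAt.fderiv

lemma hasGradientAt_ite_norm {f : E → ℝ} {f' x : E} {c : E} {r : ℝ}
    (hf : HasGradientAt f f' x) (h0 : ‖x - c‖ = r → f x = 0 ∧ f' = 0) :
    HasGradientAt (fun x => if r < ‖x - c‖ then f x else 0)
      (if r < ‖x - c‖ then f' else 0) x := by
  have hc : Continuous fun x : E => ‖x - c‖ := by fun_prop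
  rw [hasGradientAt_iff_hasFDerivAt] at *
  rcases lt_trichotomy r ‖x - c‖ with h | h | h
  · rw [if_pos h]
    refine hf.congr_of_eventuallyEq ?_
    filter_upwards [hc.continuousAt.eventually (lt_mem_nhds h)] with x' hx'
    rw [if_pos hx']
  · obtain ⟨h1, h2⟩ := h0 h.symm
    rw [if_neg h.not_lt, map_zero]
    rw [h2, map_zero] at hf
    rw [hasFDerivAt_iff_isLittleO] at *
    refine Asymptotics.IsBigO.trans_isLittleO (.of_bound 1 (.of_forall fun x' => ?_)) hf
    simp only [h, lt_self_iff_false, if_false, h1]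
    split_ifs <;> simp
  · rw [if_neg (lt_asymm h), map_zero]
    refine (hasFDerivAt_const (0 : ℝ) x).congr_of_eventuallyEq ?_
    filter_upwards [hc.continuousAt.eventually (gt_mem_nhds h)] with x' hx'
    rw [if_neg (lt_asymm hx')]

lemma exists_ball_fluxMap_bounds {p : ℝ} (hp : 1 < p) {O : Set E} (hO : IsOpen O) {u v : E → ℝ}
    (hu : ContDiffOn ℝ 1 u O) (hv : ContDiffOn ℝ 1 v O) {z : E} (hz : z ∈ O)
    (hg : gradient u z = gradient v z) (hne : gradient u z ≠ 0) :
    ∃ δ > 0, ball z δ ⊆ O ∧ ∃ a > 0, ∃ b > 0, ∀ x ∈ ball z δ,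
      a * ‖gradient v x - gradient u x‖ ^ 2 ≤
        ⟪fluxMap p (gradient v x) - fluxMap p (gradient u x), gradient v x - gradient u x⟫ ∧
      ‖fluxMap p (gradient v x) - fluxMap p (gradient u x)‖ ≤
        b * ‖gradient v x - gradient u x‖ := by
  obtain ⟨a, ha, b, hb, U, hU, h⟩ := fluxMap_local_bounds hp hne
  have hzO := hO.mem_nhds hz
  have h1 := (continuousOn_gradient hO hu).continuousAt hzO |>.eventually hU
  have h2 := (continuousOn_gradient hO hv).continuousAt hzO |>.eventually (hg ▸ hU)
  obtain ⟨δ, hδ, h3⟩ := Metric.eventually_nhds_iff_ball.1 ((h1.and h2).and hzO)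
  exact ⟨δ, hδ, fun x hx => (h3 x hx).2, a, ha, b, hb,
    fun x hx => h _ (h3 x hx).1.2 _ (h3 x hx).1.1⟩

lemma hasGradientAt_sub_of_contDiffOn {O : Set E} (hO : IsOpen O) {u v : E → ℝ}
    (hu : ContDiffOn ℝ 1 u O) (hv : ContDiffOn ℝ 1 v O) {x : E} (hx : x ∈ O) :
    HasGradientAt (fun x => v x - u x) (gradient v x - gradient u x) x := by
  rw [hasGradientAt_iff_hasFDerivAt, map_sub]
  exact (hasGradientAt_of_contDiffOn hO hv hx).hasFDerivAt.sub
    (hasGradientAt_of_contDiffOn hO hu hx).hasFDerivAt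

variable [MeasurableSpace E] [BorelSpace E]

/-- Two ordered weak solutions that touch at a noncritical point in the closure of the interior
of their coincidence set agree nearby. -/
lemma eventuallyEq_of_mem_closure {p : ℝ} (hp : 1 < p) {O : Set E} (hO : IsOpen O) {u v : E → ℝ}
    {h : ℝ} (hu : ContDiffOn ℝ 1 u O) (hv : ContDiffOn ℝ 1 v O)
    (hwu : IsWeakDiv O (fun x => fluxMap p (gradient u x)) h)
    (hwv : IsWeakDiv O (fun x => fluxMap p (gradient v x)) h)
    (hle : ∀ x ∈ O, u x ≤ v x) {z : E} (hz : z ∈ O)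
    (hg : gradient u z = gradient v z) (hne : gradient u z ≠ 0)
    (hcl : z ∈ closure {x | u =ᶠ[nhds x] v}) : u =ᶠ[nhds z] v := by
  obtain ⟨δ, hδ, hδO, a, ha, b, hb, hab⟩ := exists_ball_fluxMap_bounds hp hO hu hv hz hg hne
  obtain ⟨q, hq1, hq2⟩ := Metric.mem_closure_iff.1 hcl (δ / 2) (by positivity)
  have hgr : ∀ x ∈ ball z δ, gradient (fun x => v x - u x) x = gradient v x - gradient u x :=
    fun x hx => (hasGradientAt_sub_of_contDiffOn hO hu hv (hδO hx)).gradient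
  have hFc : ∀ {f : E → ℝ}, ContDiffOn ℝ 1 f O →
      ContinuousOn (fun x => fluxMap p (gradient f x)) O := fun hf =>
    (continuous_fluxMap (E := E) hp).comp_continuousOn (continuousOn_gradient hO hf)
  have hdiv := (hwv.sub hO (hFc hv) (hFc hu) hwu).mono hδO
  rw [sub_self] at hdiv
  filter_upwards [ball_mem_nhds z (half_pos hδ)] with x hx
  have := eq_zero_of_isWeakDiv_of_eventuallyEq (w := fun x => v x - u x)
    ((hv.sub hu).mono hδO) (((hFc hv).sub (hFc hu)).mono hδO) ha hb
    (fun x hx => by rw [hgr x hx]; exact (hab x hx).1)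
    (fun x hx => by rw [hgr x hx]; exact (hab x hx).2)
    (fun x hx => sub_nonneg.2 (hle x (hδO hx))) hdiv (q := q) (by rwa [mem_ball, dist_comm])
    (by filter_upwards [hq1] with x' hx'; rw [hx', sub_self]) hx
  linarith

/-- Uniqueness for the Cauchy problem on a sphere for ordered weak solutions, near a noncritical
point. -/
lemma eventually_eq_of_eq_on_sphere {p : ℝ} (hp : 1 < p) {O : Set E} (hO : IsOpen O) {u v : E → ℝ}
    {h : ℝ} (hu : ContDiffOn ℝ 1 u O) (hv : ContDiffOn ℝ 1 v O) {c : E} {r : ℝ} (hr : 0 < r)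
    (hwu : IsWeakDiv (O ∩ {x | r < ‖x - c‖}) (fun x => fluxMap p (gradient u x)) h)
    (hwv : IsWeakDiv (O ∩ {x | r < ‖x - c‖}) (fun x => fluxMap p (gradient v x)) h)
    (hle : ∀ x ∈ O, r < ‖x - c‖ → u x ≤ v x)
    (hS : ∀ x ∈ O, ‖x - c‖ = r → u x = v x ∧ gradient u x = gradient v x) {z : E} (hz : z ∈ O)
    (hzr : ‖z - c‖ = r) (hne : gradient u z ≠ 0) :
    ∀ᶠ x in nhds z, r < ‖x - c‖ → u x = v x := by
  obtain ⟨δ, hδ, hδO, a, ha, b, hb, hab⟩ :=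
    exists_ball_fluxMap_bounds hp hO hu hv hz (hS z hz hzr).2 hne
  have hcont : Continuous fun x : E => ‖x - c‖ := by fun_prop
  have hPo : IsOpen {x : E | r < ‖x - c‖} := isOpen_lt continuous_const hcont
  set w : E → ℝ := fun x => if r < ‖x - c‖ then v x - u x else 0 with hw
  set F : E → E := fun x => if r < ‖x - c‖ then
    fluxMap p (gradient v x) - fluxMap p (gradient u x) else 0 with hF
  set G : E → E := fun x => if r < ‖x - c‖ then gradient v x - gradient u x else 0 with hG
  have hFc : ∀ {f : E → ℝ}, ContDiffOn ℝ 1 f O →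
      ContinuousOn (fun x => fluxMap p (gradient f x)) O := fun hf =>
    (continuous_fluxMap (E := E) hp).comp_continuousOn (continuousOn_gradient hO hf)
  have hGc : ContinuousOn G O := continuousOn_ite_norm hO
    ((continuousOn_gradient hO hv).sub (continuousOn_gradient hO hu))
    fun x hx hxr => by simp [(hS x hx hxr).2]
  have hFcont : ContinuousOn F O := continuousOn_ite_norm hO ((hFc hv).sub (hFc hu))
    fun x hx hxr => by simp [(hS x hx hxr).2]
  have hwG : ∀ x ∈ O, HasGradientAt w (G x) x := fun x hx =>
    hasGradientAt_ite_norm (hasGradientAt_sub_of_contDiffOn hO hu hv hx) fun hxr =>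
      ⟨by rw [(hS x hx hxr).1, sub_self], by rw [(hS x hx hxr).2, sub_self]⟩
  have hwC : ContDiffOn ℝ 1 w O := contDiffOn_one_of_hasGradientAt hO hGc hwG
  have hgr : ∀ x ∈ ball z δ, gradient w x = G x := fun x hx => (hwG x (hδO hx)).gradient
  have hdivO : IsWeakDiv O F 0 := by
    refine isWeakDiv_of_isWeakDiv_diff_closedBall hO hFcont hr
      (fun x _ hx => if_neg (not_lt.2 hx)) ?_
    have h1 := hwv.sub (hO.inter hPo) ((hFc hv).mono inter_subset_left)
      ((hFc hu).mono inter_subset_left) hwu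
    rw [sub_self] at h1
    intro φ hφ
    rw [← h1 φ hφ]
    congr 1
    ext x
    by_cases hx : r < ‖x - c‖
    · rw [hF]
      simp only [if_pos hx]
    · rw [gradient_eq_zero_of_notMem_tsupport fun h => hx (hφ.2.2 h).2, inner_zero_right,
        inner_zero_right]
  set t : ℝ := min (1 / 2) (δ / (4 * r)) with ht
  have ht0 : 0 < t := by positivity
  have ht1 : t ≤ 1 / 2 := min_le_left _ _
  have ht2 : t * r ≤ δ / 4 := by
    have : t ≤ δ / (4 * r) := min_le_right _ _
    rw [le_div_iff₀ (by positivity)] at this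
    linarith
  set q := z - t • (z - c) with hq
  have hqc : ‖q - c‖ < r := by
    have : q - c = (1 - t) • (z - c) := by rw [hq]; module
    rw [this, norm_smul, Real.norm_of_nonneg (by linarith), hzr]
    nlinarith
  have hqz : q ∈ ball z (δ / 2) := by
    rw [mem_ball, dist_eq_norm, hq, sub_sub_cancel_left, norm_neg, norm_smul,
      Real.norm_of_nonneg ht0.le, hzr]
    linarith
  filter_upwards [ball_mem_nhds z (half_pos hδ)] with x hx hxr
  have := eq_zero_of_isWeakDiv_of_eventuallyEq (w := w) (hwC.mono hδO) (hFcont.mono hδO) ha hb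
    (fun x hx => by
      rw [hgr x hx]
      simp only [hG, hF]
      split_ifs
      · exact (hab x hx).1
      · simp)
    (fun x hx => by
      rw [hgr x hx]
      simp only [hG, hF]
      split_ifs
      · exact (hab x hx).2
      · simp)
    (fun x hx => by
      simp only [hw]
      split_ifs with h'
      · exact sub_nonneg.2 (hle x (hδO hx) h')
      · exact le_rfl)
    (hdivO.mono hδO) hqz
    (by
      filter_upwards [hcont.continuousAt.eventually (gt_mem_nhds hqc)] with x' hx'
      exact if_neg (lt_asymm hx')) hx
  simp only [hw, if_pos hxr] at this
  linarith

end Touching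

section Reflection

variable {E : Type*} [NormedAddCommGroup E] [InnerProductSpace ℝ E]

/-- Reflection across the hyperplane `⟪x, e⟫ = l`, for a unit vector `e`. -/
def hyperplaneReflection (e : E) (l : ℝ) (x : E) : E := x - (2 * (⟪x, e⟫ - l)) • e

lemma hyperplaneReflection_of_inner_eq {e x : E} {l : ℝ} (h : ⟪x, e⟫ = l) :
    hyperplaneReflection e l x = x := by simp [hyperplaneReflection, h]

lemma norm_hyperplaneReflection_sub_sq {e : E} (he : ‖e‖ = 1) (l : ℝ) (x c : E) :
    ‖hyperplaneReflection e l x - c‖ ^ 2 =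
      ‖x - c‖ ^ 2 + 4 * (⟪x, e⟫ - l) * (⟪c, e⟫ - l) := by
  have h : hyperplaneReflection e l x - c = (x - c) - (2 * (⟪x, e⟫ - l)) • e := by
    rw [hyperplaneReflection]; abel
  rw [h, norm_sub_sq_real, inner_smul_right, norm_smul, he, inner_sub_left, mul_one,
    Real.norm_eq_abs, sq_abs]
  ring

lemma continuous_hyperplaneReflection (e : E) (l : ℝ) :
    Continuous (hyperplaneReflection e l) := by
  unfold hyperplaneReflection
  fun_prop

lemma contDiff_hyperplaneReflection (e : E) (l : ℝ) :
    ContDiff ℝ 1 (hyperplaneReflection e l) :=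
  contDiff_id.sub ((contDiff_const.mul ((contDiff_id.inner ℝ contDiff_const).sub
    contDiff_const)).smul contDiff_const)

variable [FiniteDimensional ℝ E]

omit [FiniteDimensional ℝ E] in
lemma hyperplaneReflection_eq {e : E} (he : ‖e‖ = 1) (l : ℝ) (x : E) :
    hyperplaneReflection e l x = (ℝ ∙ e)ᗮ.reflection x + (2 * l) • e := by
  rw [Submodule.reflection_orthogonal_apply, Submodule.reflection_singleton_apply,
    hyperplaneReflection, real_inner_comm]
  simp only [he, RCLike.ofReal_real_eq_id, id, one_pow, div_one]
  module

omit [FiniteDimensional ℝ E] in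
lemma fluxMap_map (p : ℝ) (S : E ≃ₗᵢ[ℝ] E) (a : E) : fluxMap p (S a) = S (fluxMap p a) := by
  simp [fluxMap]

lemma gradient_comp_isometry (f : E → ℝ) (S : E ≃ₗᵢ[ℝ] E) (b x : E) :
    gradient (fun x => f (S x + b)) x = S.symm (gradient f (S x + b)) := by
  refine ext_inner_right ℝ fun z => ?_
  rw [inner_gradient_left]
  have h1 : fderiv ℝ (fun x => f (S x + b)) x =
      (fderiv ℝ f (S x + b)).comp (S.toContinuousLinearEquiv : E →L[ℝ] E) := by
    have := S.toContinuousLinearEquiv.comp_right_fderiv (f := fun z => f (z + b)) (x := x)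
    rw [fderiv_comp_add_right] at this
    exact this
  have h2 : ⟪S.symm (gradient f (S x + b)), z⟫ = ⟪gradient f (S x + b), S z⟫ := by
    rw [← S.inner_map_map, S.apply_symm_apply]
  rw [h1, h2, inner_gradient_left]
  rfl

lemma gradient_comp_hyperplaneReflection {e : E} (he : ‖e‖ = 1) (l : ℝ) (f : E → ℝ) (x : E) :
    gradient (fun x => f (hyperplaneReflection e l x)) x =
      (ℝ ∙ e)ᗮ.reflection (gradient f (hyperplaneReflection e l x)) := by
  simp_rw [hyperplaneReflection_eq he]
  rw [gradient_comp_isometry, Submodule.reflection_symm]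

variable [MeasurableSpace E] [BorelSpace E]

lemma IsWeakDiv.comp_isometry {p : ℝ} {y : E → ℝ} {U V : Set E} {h : ℝ}
    (hw : IsWeakDiv V (fun x => fluxMap p (gradient y x)) h) (S : E ≃ₗᵢ[ℝ] E) (b : E)
    (hUV : ∀ x ∈ U, S x + b ∈ V) :
    IsWeakDiv U (fun x => fluxMap p (gradient (fun x => y (S x + b)) x)) h := by
  intro φ hφ
  set ψ : E → ℝ := fun x => φ (S.symm x + -S.symm b) with hψ
  have hinv : ∀ x, S.symm (S x + b) + -S.symm b = x := fun x => by simp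
  have hinv' : ∀ x, S (S.symm x + -S.symm b) + b = x := fun x => by simp
  have hcont : Continuous fun x => S.symm x + -S.symm b := by fun_prop
  have hψt : tsupport ψ ⊆ (fun x => S.symm x + -S.symm b) ⁻¹' tsupport φ :=
    closure_minimal (fun x hx => subset_tsupport φ hx) ((isClosed_tsupport φ).preimage hcont)
  have hψT : IsC1Test V ψ := by
    refine ⟨hφ.1.comp (S.symm.contDiff.add contDiff_const), ?_, fun x hx => ?_⟩
    · refine HasCompactSupport.of_support_subset_isCompact
        (hφ.2.1.isCompact.image (S.continuous.add continuous_const)) (K := (fun x => S x + b) ''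
          tsupport φ) fun x hx => ⟨_, hψt (subset_tsupport ψ hx), hinv' x⟩
    · rw [← hinv' x]
      exact hUV _ (hφ.2.2 (hψt hx))
  have hcv : ∀ g : E → ℝ, ∫ x, g (S x + b) = ∫ x, g x := fun g => by
    have := (S.measurePreserving).integral_comp S.toHomeomorph.measurableEmbedding
      (fun x => g (x + b))
    rw [this, integral_add_right_eq_self]
  have h1 := hw ψ hψT
  rw [← hcv, ← hcv ψ] at h1
  simp_rw [hψ, hinv] at h1
  rw [← h1]
  congr 1
  ext x
  beta_reduce
  rw [gradient_comp_isometry y, fluxMap_map, gradient_comp_isometry φ, hinv,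
    LinearIsometryEquiv.symm_symm, ← S.inner_map_map, S.apply_symm_apply]

/-- `y` is a weak solution of `-Δ_p y = 1` in the eccentric annulus bounded by the spheres
`S(0, r1)` and `S(s e, r0)`, positive inside, zero on the boundary and `C^1` on the open
neighbourhood `W` of its closure. -/
structure IsAnnulusTorsion (p r0 r1 s : ℝ) (e : E) (y : E → ℝ) (W : Set E) : Prop where
  one_lt : 1 < p
  r0_pos : 0 < r0
  s_pos : 0 < s
  s_add_lt : s + r0 < r1
  norm_e : ‖e‖ = 1
  isOpen : IsOpen W
  mem : ∀ x, ‖x‖ ≤ r1 → r0 ≤ ‖x - s • e‖ → x ∈ W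
  contDiffOn : ContDiffOn ℝ 1 y W
  outer : ∀ x, ‖x‖ = r1 → y x = 0
  inner : ∀ x, ‖x - s • e‖ = r0 → y x = 0
  pos : ∀ x, ‖x‖ < r1 → r0 < ‖x - s • e‖ → 0 < y x
  weak : IsWeakDiv {x | ‖x‖ < r1 ∧ r0 < ‖x - s • e‖} (fun x => fluxMap p (gradient y x)) 1

namespace IsAnnulusTorsion

variable {p r0 r1 s : ℝ} {e : E} {y : E → ℝ} {W : Set E}

omit [InnerProductSpace ℝ E] [FiniteDimensional ℝ E] [MeasurableSpace E] [BorelSpace E] in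
lemma isOpen_annulus (r0 r1 : ℝ) (c : E) : IsOpen {x : E | ‖x‖ < r1 ∧ r0 < ‖x - c‖} :=
  (isOpen_lt continuous_norm continuous_const).inter
    (isOpen_lt continuous_const (continuous_id.sub continuous_const).norm)

lemma nonneg (H : IsAnnulusTorsion p r0 r1 s e y W) {x : E} (h1 : ‖x‖ ≤ r1)
    (h2 : r0 ≤ ‖x - s • e‖) : 0 ≤ y x := by
  rcases h1.eq_or_lt with h1 | h1
  · exact (H.outer x h1).ge
  rcases h2.eq_or_lt with h2 | h2
  · exact (H.inner x h2.symm).ge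
  exact (H.pos x h1 h2).le

/-- Moving planes: `y` increases under reflection away from the hole's far side. -/
lemma le_reflection (H : IsAnnulusTorsion p r0 r1 s e y W) {u : E} (hu : ‖u‖ = 1) {l : ℝ}
    (hl0 : 0 ≤ l) (hl1 : l ≤ ⟪s • e, u⟫) {x : E} (h1 : ‖x‖ ≤ r1) (h2 : r0 ≤ ‖x - s • e‖)
    (hx : l ≤ ⟪x, u⟫) : y x ≤ y (hyperplaneReflection u l x) := by
  have : Nontrivial E := ⟨u, 0, fun h => by simp [h] at hu⟩
  set c := s • e with hc
  set σ := hyperplaneReflection u l with hσ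
  have hn1 : ∀ x, l ≤ ⟪x, u⟫ → ‖σ x‖ ≤ ‖x‖ := fun x hx => by
    have := norm_hyperplaneReflection_sub_sq hu l x 0
    simp only [sub_zero, inner_zero_left, zero_sub] at this
    refine le_of_sq_le_sq ?_ (norm_nonneg _)
    nlinarith
  have hn2 : ∀ x, l ≤ ⟪x, u⟫ → ‖x - c‖ ≤ ‖σ x - c‖ := fun x hx => by
    have := norm_hyperplaneReflection_sub_sq hu l x c
    refine le_of_sq_le_sq ?_ (norm_nonneg _)
    nlinarith [mul_nonneg (sub_nonneg.2 hx) (sub_nonneg.2 hl1)]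
  have hnn : ∀ x, ‖x‖ ≤ r1 → r0 ≤ ‖x - c‖ → l ≤ ⟪x, u⟫ → 0 ≤ y (σ x) := fun x h1 h2 h3 =>
    H.nonneg ((hn1 x h3).trans h1) (h2.trans (hn2 x h3))
  have hbd : ∀ x, ‖x‖ ≤ r1 → r0 ≤ ‖x - c‖ → l ≤ ⟪x, u⟫ →
      ¬ ((‖x‖ < r1 ∧ r0 < ‖x - c‖) ∧ l < ⟪x, u⟫) → y x ≤ y (σ x) := by
    intro x h1 h2 h3 h4
    rcases h1.eq_or_lt with h1' | h1'
    · rw [H.outer x h1']; exact hnn x h1 h2 h3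
    rcases h2.eq_or_lt with h2' | h2'
    · rw [H.inner x h2'.symm]; exact hnn x h1 h2 h3
    rcases h3.eq_or_lt with h3' | h3'
    · rw [hσ, hyperplaneReflection_of_inner_eq h3'.symm]
    · exact absurd ⟨⟨h1', h2'⟩, h3'⟩ h4
  by_cases hxO : (‖x‖ < r1 ∧ r0 < ‖x - c‖) ∧ l < ⟪x, u⟫
  swap
  · exact hbd x h1 h2 hx hxO
  set O : Set E := {x | ‖x‖ < r1 ∧ r0 < ‖x - c‖} ∩ {x | l < ⟪x, u⟫} with hO
  have hic : Continuous fun x : E => ⟪x, u⟫ := by fun_prop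
  have hOo : IsOpen O := (isOpen_annulus r0 r1 c).inter (isOpen_lt continuous_const hic)
  have hcl : closure O ⊆ {x | (‖x‖ ≤ r1 ∧ r0 ≤ ‖x - c‖) ∧ l ≤ ⟪x, u⟫} := by
    refine closure_minimal (fun z hz => ⟨⟨hz.1.1.le, hz.1.2.le⟩, le_of_lt hz.2⟩) ?_
    exact ((isClosed_le continuous_norm continuous_const).inter
      (isClosed_le continuous_const (continuous_id.sub continuous_const).norm)).inter (isClosed_le continuous_const hic)
  have hKW : closure O ⊆ W := fun z hz => H.mem z (hcl hz).1.1 (hcl hz).1.2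
  have hσW : MapsTo σ (closure O) W := fun z hz =>
    H.mem _ ((hn1 z (hcl hz).2).trans (hcl hz).1.1) ((hcl hz).1.2.trans (hn2 z (hcl hz).2))
  have hvC : ContDiffOn ℝ 1 (fun x => y (σ x)) O :=
    H.contDiffOn.comp (contDiff_hyperplaneReflection u l).contDiffOn
      (hσW.mono_left subset_closure)
  have hvw : IsWeakDiv O (fun x => fluxMap p (gradient (fun x => y (σ x)) x)) 1 := by
    have := H.weak.comp_isometry (U := O) ((ℝ ∙ u)ᗮ.reflection) ((2 * l) • u) (fun z hz => by
      rw [← hyperplaneReflection_eq hu]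
      exact ⟨(hn1 z (le_of_lt hz.2)).trans_lt hz.1.1, hz.1.2.trans_le (hn2 z (le_of_lt hz.2))⟩)
    simp_rw [← hyperplaneReflection_eq hu] at this
    exact this
  refine le_of_isWeakDiv_fluxMap H.one_lt hOo ?_ (H.contDiffOn.continuousOn.mono hKW)
    (H.contDiffOn.continuousOn.comp (continuous_hyperplaneReflection u l).continuousOn hσW)
    (H.contDiffOn.mono (subset_closure.trans hKW)) hvC (H.weak.mono inter_subset_left) hvw
    (fun z hz1 hz2 => hbd z (hcl hz1).1.1 (hcl hz1).1.2 (hcl hz1).2 hz2) hxO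
  exact isBounded_ball.subset fun z hz => mem_ball_zero_iff.2 hz.1.1

/-- On spheres about the centre of the hole, `y` decreases in the direction of `e`. -/
lemma le_of_norm_sub_eq (H : IsAnnulusTorsion p r0 r1 s e y W) {x x' : E} (h1 : ‖x‖ ≤ r1)
    (h2 : r0 ≤ ‖x - s • e‖) (hn : ‖x - s • e‖ = ‖x' - s • e‖) (hx : ⟪x', e⟫ ≤ ⟪x, e⟫) :
    y x ≤ y x' := by
  rcases eq_or_ne x x' with rfl | hne
  · exact le_rfl
  set n := ‖x - x'‖ with hn'
  have hn0 : 0 < n := norm_pos_iff.2 (sub_ne_zero.2 hne)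
  set u := n⁻¹ • (x - x') with hu
  have hu1 : ‖u‖ = 1 := by
    rw [hu, norm_smul, Real.norm_of_nonneg (by positivity), ← hn', inv_mul_cancel₀ hn0.ne']
  have hl : 0 ≤ ⟪s • e, u⟫ := by
    rw [hu, real_inner_smul_left, real_inner_smul_right, inner_sub_right, real_inner_comm x,
      real_inner_comm x']
    have := H.s_pos
    have := sub_nonneg.2 hx
    positivity
  have hd : ⟪x, u⟫ - ⟪s • e, u⟫ = n / 2 := by
    rw [← inner_sub_left, hu, real_inner_smul_right]
    have h3 : x' - s • e = (x - s • e) - (x - x') := by abel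
    have h4 : ‖x' - s • e‖ ^ 2 = ‖x - s • e‖ ^ 2 - 2 * ⟪x - s • e, x - x'⟫ + n ^ 2 := by
      rw [h3, norm_sub_sq_real]
    rw [← hn] at h4
    have h5 : ⟪x - s • e, x - x'⟫ = n ^ 2 / 2 := by linarith
    rw [h5]
    field_simp
  have h6 := H.le_reflection hu1 hl le_rfl h1 h2 (by linarith)
  have h7 : hyperplaneReflection u ⟪s • e, u⟫ x = x' := by
    rw [hyperplaneReflection, hd, hu, smul_smul]
    have : 2 * (n / 2) * n⁻¹ = 1 := by field_simp
    rw [this, one_smul, sub_sub_cancel]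
  rwa [h7] at h6

end IsAnnulusTorsion

end Reflection

section Torsion

lemma HasDerivAt.nonneg_of_eventually_le {k : ℝ → ℝ} {k' t : ℝ} (hk : HasDerivAt k k' t)
    (h : ∀ᶠ x in nhdsWithin t (Ioi t), k t ≤ k x) : 0 ≤ k' := by
  have h1 := (hasDerivAt_iff_tendsto_slope.1 hk).mono_left
    (show nhdsWithin t (Ioi t) ≤ nhdsWithin t {t}ᶜ from
      nhdsWithin_mono t fun x hx => ne_of_gt hx)
  refine ge_of_tendsto h1 ?_
  filter_upwards [h, self_mem_nhdsWithin] with x hx hx'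
  rw [slope_def_field]
  exact div_nonneg (sub_nonneg.2 hx) (sub_nonneg.2 (le_of_lt hx'))

variable {E : Type*} [NormedAddCommGroup E] [InnerProductSpace ℝ E] [FiniteDimensional ℝ E]
  [MeasurableSpace E] [BorelSpace E]

namespace IsAnnulusTorsion

variable {p r0 r1 s : ℝ} {e : E} {y : E → ℝ} {W : Set E}

lemma hasGradientAt (H : IsAnnulusTorsion p r0 r1 s e y W) {x : E} (h1 : ‖x‖ ≤ r1)
    (h2 : r0 ≤ ‖x - s • e‖) : HasGradientAt y (gradient y x) x :=
  hasGradientAt_of_contDiffOn H.isOpen H.contDiffOn (H.mem x h1 h2)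

lemma norm_center (H : IsAnnulusTorsion p r0 r1 s e y W) : ‖s • e‖ = s := by
  rw [norm_smul, H.norm_e, mul_one, Real.norm_of_nonneg H.s_pos.le]

lemma inner_center (H : IsAnnulusTorsion p r0 r1 s e y W) : ⟪s • e, e⟫ = s := by
  rw [real_inner_smul_left, real_inner_self_eq_norm_sq, H.norm_e]; ring

lemma norm_sq_eq (H : IsAnnulusTorsion p r0 r1 s e y W) (x : E) :
    ‖x‖ ^ 2 = ‖x - s • e‖ ^ 2 + 2 * s * ⟪x - s • e, e⟫ + s ^ 2 := by
  have h : x = (x - s • e) + s • e := by abel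
  conv_lhs => rw [h]
  rw [norm_add_sq_real, H.norm_center, real_inner_smul_right]
  ring

lemma norm_le_of_norm_sub_eq (H : IsAnnulusTorsion p r0 r1 s e y W) {x x' : E}
    (hn : ‖x - s • e‖ = ‖x' - s • e‖) (hx : ⟪x' - s • e, e⟫ ≤ ⟪x - s • e, e⟫) : ‖x'‖ ≤ ‖x‖ := by
  have h1 := H.norm_sq_eq x
  have h2 := H.norm_sq_eq x'
  have := H.s_pos
  refine le_of_sq_le_sq ?_ (norm_nonneg _)
  rw [hn] at h1
  nlinarith

lemma norm_lt_of_inner (H : IsAnnulusTorsion p r0 r1 s e y W) {z : E} (hz : ‖z - s • e‖ = r0) :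
    ‖z‖ < r1 := by
  have h := norm_add_le (z - s • e) (s • e)
  rw [sub_add_cancel, H.norm_center, hz] at h
  linarith [H.s_add_lt]

/-- Hopf lemma for a ball contained in the annulus. -/
lemma hopf (H : IsAnnulusTorsion p r0 r1 s e y W) {q z : E} {R : ℝ} (hR : 0 < R)
    (h1 : ∀ w ∈ closedBall q R, ‖w‖ ≤ r1 ∧ r0 ≤ ‖w - s • e‖)
    (h2 : ∀ w ∈ ball q R, ‖w‖ < r1 ∧ r0 < ‖w - s • e‖)
    (hz : z ∈ sphere q R) (hM : ∀ w ∈ sphere q R, y z ≤ y w) :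
    0 < ⟪gradient y z, q - z⟫ := by
  have : Nontrivial E := ⟨e, 0, fun h => by simpa [h] using H.norm_e⟩
  exact inner_gradient_pos_of_isWeakDiv_ball H.one_lt hR H.isOpen
    (fun w hw => H.mem w (h1 w hw).1 (h1 w hw).2) H.contDiffOn (H.weak.mono h2) hM hz rfl

lemma inner_gradient_pos (H : IsAnnulusTorsion p r0 r1 s e y W) {z : E}
    (hz : ‖z - s • e‖ = r0) : 0 < ⟪gradient y z, z - s • e⟫ := by
  set c := s • e with hc
  have hr := H.r0_pos
  have hs := H.s_add_lt
  set t := (r1 - s - r0) / (2 * r0) with ht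
  have ht0 : 0 < t := div_pos (by linarith) (by linarith)
  have htr : 2 * (t * r0) = r1 - s - r0 := by rw [ht]; field_simp
  set q := z + t • (z - c) with hq
  have hqc : ‖q - c‖ = (1 + t) * r0 := by
    have : q - c = (1 + t) • (z - c) := by rw [hq]; module
    rw [this, norm_smul, hz, Real.norm_of_nonneg (by linarith)]
  have hqz : q - z = t • (z - c) := by rw [hq]; abel
  have hb1 : ∀ w, ‖w‖ ≤ ‖w - q‖ + (t * r0 + r0 + s) := fun w => by
    have h1 : ‖w‖ ≤ ‖w - q‖ + ‖q‖ := by simpa using norm_add_le (w - q) q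
    have h2 : ‖q‖ ≤ ‖q - c‖ + ‖c‖ := by simpa using norm_add_le (q - c) c
    rw [hqc, H.norm_center] at h2
    linarith
  have hb2 : ∀ w, (1 + t) * r0 ≤ ‖w - q‖ + ‖w - c‖ := fun w => by
    rw [← hqc, norm_sub_rev w q]
    simpa using norm_add_le (q - w) (w - c)
  have h1 : ∀ w ∈ closedBall q (t * r0), ‖w‖ ≤ r1 ∧ r0 ≤ ‖w - c‖ := fun w hw => by
    rw [mem_closedBall_iff_norm] at hw
    constructor <;> linarith [hb1 w, hb2 w]
  have h2 : ∀ w ∈ ball q (t * r0), ‖w‖ < r1 ∧ r0 < ‖w - c‖ := fun w hw => by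
    rw [mem_ball_iff_norm] at hw
    constructor <;> linarith [hb1 w, hb2 w]
  have h := H.hopf (mul_pos ht0 hr) h1 h2 (z := z)
    (by rw [mem_sphere_iff_norm, norm_sub_rev, hqz, norm_smul, hz, Real.norm_of_nonneg ht0.le])
    (fun w hw => by
      rw [H.inner z hz]
      have := h1 w (sphere_subset_closedBall hw)
      exact H.nonneg this.1 this.2)
  rw [hqz, real_inner_smul_right] at h
  exact pos_of_mul_pos_right h ht0.le

lemma hasDerivAt_line (H : IsAnnulusTorsion p r0 r1 s e y W) {c v : E} {t : ℝ}
    (h1 : ‖c + t • v‖ ≤ r1) (h2 : r0 ≤ ‖c + t • v - s • e‖) :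
    HasDerivAt (fun t : ℝ => y (c + t • v)) ⟪gradient y (c + t • v), v⟫ t := by
  have h3 := (H.hasGradientAt h1 h2).hasFDerivAt
  have hγ : HasDerivAt (fun t : ℝ => c + t • v) v t := by
    simpa using ((hasDerivAt_id t).smul_const v).const_add c
  have := HasFDerivAt.comp_hasDerivAt (f := fun t : ℝ => c + t • v) t h3 hγ
  rwa [InnerProductSpace.toDual_apply_apply] at this

lemma gradient_eq_smul (H : IsAnnulusTorsion p r0 r1 s e y W) {z : E}
    (hz : ‖z - s • e‖ = r0) :
    gradient y z = (⟪gradient y z, z - s • e⟫ / r0 ^ 2) • (z - s • e) := by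
  set c := s • e with hc
  set a := ⟪gradient y z, z - c⟫ / r0 ^ 2 with ha
  have hr := H.r0_pos
  have h0 : z + (0 : ℝ) • (gradient y z - a • (z - c)) = z := by simp
  set τ := gradient y z - a • (z - c) with hτ
  have hτ0 : ⟪z - c, τ⟫ = 0 := by
    rw [hτ, inner_sub_right, real_inner_comm, real_inner_smul_right, real_inner_self_eq_norm_sq,
      hz, ha]
    field_simp
    ring
  have hd := H.hasDerivAt_line (c := z) (v := τ) (t := 0) (by
    rw [h0]; exact (H.norm_lt_of_inner hz).le) (by rw [h0]; exact hz.ge)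
  have hcont : Continuous fun t : ℝ => ‖z + t • τ‖ := by fun_prop
  have hmin : IsLocalMin (fun t : ℝ => y (z + t • τ)) 0 := by
    filter_upwards [hcont.continuousAt.eventually_lt (x₀ := 0) continuousAt_const
      (by rw [h0]; exact H.norm_lt_of_inner hz)] with t ht
    rw [h0, H.inner z hz]
    refine H.nonneg (le_of_lt ht) ?_
    have h3 : z + t • τ - c = (z - c) + t • τ := by abel
    rw [h3]
    refine le_of_sq_le_sq ?_ (norm_nonneg _)
    rw [norm_add_sq_real, real_inner_smul_right, hτ0, ← hz]
    nlinarith [sq_nonneg ‖t • τ‖]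
  have h4 := hmin.hasDerivAt_eq_zero hd
  rw [h0] at h4
  have h5 : ⟪τ, τ⟫ = 0 := by
    nth_rewrite 1 [hτ]
    rw [inner_sub_left, h4, real_inner_smul_left, hτ0]
    ring
  exact sub_eq_zero.1 (inner_self_eq_zero.1 h5)

lemma inner_gradient_le (H : IsAnnulusTorsion p r0 r1 s e y W) {z z' : E}
    (hz : ‖z - s • e‖ = r0) (hz' : ‖z' - s • e‖ = r0)
    (h : ⟪z', e⟫ ≤ ⟪z, e⟫) :
    ⟪gradient y z, z - s • e⟫ ≤ ⟪gradient y z', z' - s • e⟫ := by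
  set c := s • e with hc
  have h0 : ∀ w : E, w + (0 : ℝ) • (w - c) = w := fun w => by simp
  have hd : ∀ w : E, ‖w - c‖ = r0 →
      HasDerivAt (fun t : ℝ => y (w + t • (w - c))) ⟪gradient y w, w - c⟫ 0 := fun w hw => by
    have := H.hasDerivAt_line (c := w) (v := w - c) (t := 0)
      (by rw [h0]; exact (H.norm_lt_of_inner hw).le) (by rw [h0]; exact hw.ge)
    rwa [h0] at this
  have hcont : Continuous fun t : ℝ => ‖z + t • (z - c)‖ := by fun_prop
  refine sub_nonneg.1 (((hd z' hz').sub (hd z hz)).nonneg_of_eventually_le ?_)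
  filter_upwards [self_mem_nhdsWithin, nhdsWithin_le_nhds
    (hcont.continuousAt.eventually_lt (x₀ := 0) continuousAt_const
      (by rw [h0]; exact H.norm_lt_of_inner hz))] with t ht0 ht
  have ht0 : 0 < t := ht0
  have hn : ∀ w : E, ‖w - c‖ = r0 → ‖w + t • (w - c) - c‖ = (1 + t) * r0 := fun w hw => by
    have : w + t • (w - c) - c = (1 + t) • (w - c) := by module
    rw [this, norm_smul, hw, Real.norm_of_nonneg (by linarith)]
  simp only [Pi.sub_apply, h0, H.inner z hz, H.inner z' hz', sub_zero, sub_nonneg]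
  refine H.le_of_norm_sub_eq (le_of_lt ht) ?_ (by rw [← hc, hn z hz, hn z' hz']) ?_
  · rw [← hc, hn z hz]; nlinarith [H.r0_pos]
  · simp only [inner_add_left, real_inner_smul_left, inner_sub_left]
    nlinarith

/-- If `y` agrees at `x` and at its mirror image, then it is constant on the spherical zone
between them. -/
lemma eq_of_eq_reflection (H : IsAnnulusTorsion p r0 r1 s e y W) {x x' : E} (h1 : ‖x‖ ≤ r1)
    (h2 : r0 ≤ ‖x - s • e‖) (hxy : y x = y (hyperplaneReflection e s x))
    (hn : ‖x' - s • e‖ = ‖x - s • e‖) (hx : |⟪x' - s • e, e⟫| ≤ ⟪x - s • e, e⟫) :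
    y x' = y x := by
  have h3 := abs_le.1 hx
  have h4 := H.inner_center
  simp only [inner_sub_left, h4] at h3
  have h5 : ‖hyperplaneReflection e s x - s • e‖ = ‖x - s • e‖ := by
    have := norm_hyperplaneReflection_sub_sq H.norm_e s x (s • e)
    rw [h4, sub_self, mul_zero, add_zero] at this
    exact (sq_eq_sq₀ (norm_nonneg _) (norm_nonneg _)).1 this
  refine le_antisymm ?_ (H.le_of_norm_sub_eq h1 h2 hn.symm (by linarith))
  rw [hxy]
  refine H.le_of_norm_sub_eq ((H.norm_le_of_norm_sub_eq hn.symm (abs_le.1 hx).2).trans h1)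
    (h2.trans hn.ge) (hn.trans h5.symm) ?_
  rw [hyperplaneReflection, inner_sub_left, real_inner_smul_left, real_inner_self_eq_norm_sq,
    H.norm_e]
  linarith

end IsAnnulusTorsion

end Torsion

section TorsionRigidity

variable {E : Type*} [NormedAddCommGroup E] [InnerProductSpace ℝ E] [FiniteDimensional ℝ E]
  [MeasurableSpace E] [BorelSpace E]

namespace IsAnnulusTorsion

variable {p r0 r1 s : ℝ} {e : E} {y : E → ℝ} {W : Set E}

lemma norm_reflection_sub_center (H : IsAnnulusTorsion p r0 r1 s e y W) (x : E) :
    ‖hyperplaneReflection e s x - s • e‖ = ‖x - s • e‖ := by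
  have := norm_hyperplaneReflection_sub_sq H.norm_e s x (s • e)
  rw [H.inner_center, sub_self, mul_zero, add_zero] at this
  exact (sq_eq_sq₀ (norm_nonneg _) (norm_nonneg _)).1 this

lemma norm_reflection_le (H : IsAnnulusTorsion p r0 r1 s e y W) {x : E} (hx : s ≤ ⟪x, e⟫) :
    ‖hyperplaneReflection e s x‖ ≤ ‖x‖ := by
  have := norm_hyperplaneReflection_sub_sq H.norm_e s x 0
  simp only [sub_zero, inner_zero_left, zero_sub] at this
  refine le_of_sq_le_sq ?_ (norm_nonneg _)
  nlinarith [H.s_pos]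

lemma mapsTo_reflection (H : IsAnnulusTorsion p r0 r1 s e y W) :
    MapsTo (hyperplaneReflection e s) ({x | ‖x‖ < r1 ∧ r0 < ‖x - s • e‖} ∩ {x | s < ⟪x, e⟫})
      {x | ‖x‖ < r1 ∧ r0 < ‖x - s • e‖} := fun x hx =>
  ⟨(H.norm_reflection_le (le_of_lt hx.2)).trans_lt hx.1.1,
    hx.1.2.trans_eq (H.norm_reflection_sub_center x).symm⟩

lemma isWeakDiv_reflection (H : IsAnnulusTorsion p r0 r1 s e y W) :
    IsWeakDiv ({x | ‖x‖ < r1 ∧ r0 < ‖x - s • e‖} ∩ {x | s < ⟪x, e⟫})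
      (fun x => fluxMap p (gradient (fun x => y (hyperplaneReflection e s x)) x)) 1 := by
  have := H.weak.comp_isometry (U := {x | ‖x‖ < r1 ∧ r0 < ‖x - s • e‖} ∩ {x | s < ⟪x, e⟫})
    ((ℝ ∙ e)ᗮ.reflection) ((2 * s) • e) (fun z hz => by
      rw [← hyperplaneReflection_eq H.norm_e]
      exact H.mapsTo_reflection hz)
  simp_rw [← hyperplaneReflection_eq H.norm_e] at this
  exact this

lemma le_reflection_center (H : IsAnnulusTorsion p r0 r1 s e y W) {x : E} (h1 : ‖x‖ ≤ r1)
    (h2 : r0 ≤ ‖x - s • e‖) (hx : s ≤ ⟪x, e⟫) : y x ≤ y (hyperplaneReflection e s x) :=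
  H.le_reflection H.norm_e H.s_pos.le H.inner_center.ge h1 h2 hx

lemma eventually_eq_reflection_of_inner (H : IsAnnulusTorsion p r0 r1 s e y W) {a κ : ℝ}
    (ha : a ≠ 0)
    (hband : ∀ z, ‖z - s • e‖ = r0 → |⟪z - s • e, e⟫| < κ → gradient y z = a • (z - s • e))
    {z : E} (hz : ‖z - s • e‖ = r0) (hz0 : 0 < ⟪z - s • e, e⟫) (hzκ : ⟪z - s • e, e⟫ < κ) :
    ∀ᶠ x in nhds z, r0 < ‖x - s • e‖ → y x = y (hyperplaneReflection e s x) := by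
  set c := s • e with hc
  set σ := hyperplaneReflection e s with hσ
  have hce : ⟪c, e⟫ = s := H.inner_center
  have hsub : ∀ x, ⟪x - c, e⟫ = ⟪x, e⟫ - s := fun x => by rw [inner_sub_left, hce]
  have hic : Continuous fun x : E => ⟪x - c, e⟫ := by fun_prop
  have hσc : Continuous σ := continuous_hyperplaneReflection e s
  have hσe : ∀ x, ⟪σ x - c, e⟫ = -⟪x - c, e⟫ := fun x => by
    rw [hsub, hsub, hσ, hyperplaneReflection, inner_sub_left, real_inner_smul_left,
      real_inner_self_eq_norm_sq, H.norm_e]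
    ring
  set O : Set E := (W ∩ σ ⁻¹' W) ∩ ({x | ‖x‖ < r1} ∩
    ({x | 0 < ⟪x - c, e⟫} ∩ {x | ⟪x - c, e⟫ < κ})) with hO
  have hOo : IsOpen O := (H.isOpen.inter (H.isOpen.preimage hσc)).inter
    ((isOpen_lt continuous_norm continuous_const).inter
      ((isOpen_lt continuous_const hic).inter (isOpen_lt hic continuous_const)))
  have hsO : ∀ x ∈ O, s < ⟪x, e⟫ := fun x hx => by
    have : 0 < ⟪x - c, e⟫ := hx.2.2.1
    rw [hsub] at this
    linarith
  have hsubO : O ∩ {x | r0 < ‖x - c‖} ⊆ {x | ‖x‖ < r1 ∧ r0 < ‖x - c‖} ∩ {x | s < ⟪x, e⟫} :=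
    fun x hx => ⟨⟨hx.1.2.1, hx.2⟩, hsO x hx.1⟩
  have hzr := H.norm_lt_of_inner hz
  have hzO : z ∈ O := ⟨⟨H.mem z hzr.le hz.ge, H.mem _
    ((H.norm_reflection_le (by rw [hsub] at hz0; linarith)).trans hzr.le)
    (by rw [H.norm_reflection_sub_center]; exact hz.ge)⟩, hzr, hz0, hzκ⟩
  refine eventually_eq_of_eq_on_sphere (u := y) (v := fun x => y (σ x)) H.one_lt hOo
    (H.contDiffOn.mono fun x hx => hx.1.1)
    (H.contDiffOn.comp (contDiff_hyperplaneReflection e s).contDiffOn fun x hx => hx.1.2)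
    H.r0_pos (H.weak.mono fun x hx => (hsubO hx).1) (H.isWeakDiv_reflection.mono hsubO)
    (fun x hx hx' => H.le_reflection_center (le_of_lt hx.2.1) (le_of_lt hx') (hsO x hx).le)
    (fun x hx hxr => ?_) hzO hz ?_
  · have hσr : ‖σ x - c‖ = r0 := (H.norm_reflection_sub_center x).trans hxr
    have hx0 : 0 < ⟪x - c, e⟫ := hx.2.2.1
    have hxκ : ⟪x - c, e⟫ < κ := hx.2.2.2
    refine ⟨by rw [H.inner x hxr, H.inner _ hσr], ?_⟩
    rw [gradient_comp_hyperplaneReflection H.norm_e, ← hσ,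
      hband x hxr (by rwa [abs_of_pos hx0]),
      hband _ hσr (by rwa [hσe, abs_neg, abs_of_pos hx0]), map_smul]
    congr 1
    have h1 : σ x - c = (ℝ ∙ e)ᗮ.reflection x + s • e := by
      rw [hσ, hyperplaneReflection_eq H.norm_e, hc]
      module
    rw [h1, map_add, Submodule.reflection_reflection, map_smul,
      Submodule.reflection_orthogonalComplement_singleton_eq_neg, hc, smul_neg, sub_eq_add_neg]
  · rw [hband z hz (by rwa [abs_of_pos hz0])]
    exact smul_ne_zero ha (norm_pos_iff.1 (by rw [hz]; exact H.r0_pos))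

/-- Continuation of the mirror symmetry along a connected set without critical points. -/
lemma eventuallyEq_reflection_of_isPreconnected (H : IsAnnulusTorsion p r0 r1 s e y W)
    {P : Set E} (hP : IsPreconnected P)
    (hPO : P ⊆ {x | ‖x‖ < r1 ∧ r0 < ‖x - s • e‖} ∩ {x | s < ⟪x, e⟫})
    (hne : ∀ x ∈ P, gradient y x ≠ 0)
    (hstart : ∃ x ∈ P, y =ᶠ[nhds x] fun x => y (hyperplaneReflection e s x)) :
    ∀ x ∈ P, y =ᶠ[nhds x] fun x => y (hyperplaneReflection e s x) := by
  set v : E → ℝ := fun x => y (hyperplaneReflection e s x) with hv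
  set O : Set E := {x | ‖x‖ < r1 ∧ r0 < ‖x - s • e‖} ∩ {x | s < ⟪x, e⟫} with hO
  have hic : Continuous fun x : E => ⟪x, e⟫ := by fun_prop
  have hOo : IsOpen O := (isOpen_annulus r0 r1 _).inter (isOpen_lt continuous_const hic)
  have hyO : ContDiffOn ℝ 1 y O := H.contDiffOn.mono fun x hx => H.mem x hx.1.1.le hx.1.2.le
  have hvO : ContDiffOn ℝ 1 v O :=
    H.contDiffOn.comp (contDiff_hyperplaneReflection e s).contDiffOn fun x hx =>
      H.mem _ (H.mapsTo_reflection hx).1.le (H.mapsTo_reflection hx).2.le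
  set A : Set E := {x | y =ᶠ[nhds x] v} with hA
  have hAo : IsOpen A := isOpen_setOfPred_eventually_nhds
  refine hP.subset_of_closure_inter_subset hAo ?_ ?_
  · obtain ⟨x, hx, hx'⟩ := hstart
    exact ⟨x, hx, hx'⟩
  · rintro x ⟨hxc, hxP⟩
    have hxO := hPO hxP
    refine eventuallyEq_of_mem_closure H.one_lt hOo hyO hvO (H.weak.mono inter_subset_left)
      H.isWeakDiv_reflection
      (fun x hx => H.le_reflection_center hx.1.1.le hx.1.2.le (le_of_lt hx.2)) hxO ?_
      (hne x hxP) hxc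
    have : (nhdsWithin x A).NeBot := mem_closure_iff_nhdsWithin_neBot.1 hxc
    have hg : ∀ {f : E → ℝ}, ContDiffOn ℝ 1 f O →
        Filter.Tendsto (gradient f) (nhdsWithin x A) (nhds (gradient f x)) := fun hf =>
      (((continuousOn_gradient hOo hf).continuousAt (hOo.mem_nhds hxO)).tendsto).mono_left
        nhdsWithin_le_nhds
    refine tendsto_nhds_unique_of_eventuallyEq (hg hyO) (hg hvO) ?_
    filter_upwards [self_mem_nhdsWithin] with z hz
    simp only [gradient, Filter.EventuallyEq.fderiv_eq hz]

end IsAnnulusTorsion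

end TorsionRigidity

section TorsionRay

variable {E : Type*} [NormedAddCommGroup E] [InnerProductSpace ℝ E] [FiniteDimensional ℝ E]
  [MeasurableSpace E] [BorelSpace E]

namespace IsAnnulusTorsion

variable {p r0 r1 s : ℝ} {e : E} {y : E → ℝ} {W : Set E}

/-- If `y` is symmetric near every point of the ray segment, it is constant on the corresponding
spherical zones, the last one included. -/
lemma eq_on_zone (H : IsAnnulusTorsion p r0 r1 s e y W) {ω : E} (hω : ‖ω‖ = 1)
    (hωe : 0 < ⟪ω, e⟫) {T : ℝ} (hT0 : r0 < T) (hT1 : ‖s • e + T • ω‖ ≤ r1)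
    (hsym : ∀ t ∈ Ioo r0 T,
      y =ᶠ[nhds (s • e + t • ω)] fun x => y (hyperplaneReflection e s x)) :
    ∀ t ∈ Ioc r0 T, ∀ x, ‖x - s • e‖ = t → |⟪x - s • e, e⟫| ≤ t * ⟪ω, e⟫ →
      y x = y (s • e + t • ω) := by
  set c := s • e with hc
  have hLc : ∀ t, r0 < t → ‖c + t • ω - c‖ = t := fun t ht => by
    rw [add_sub_cancel_left, norm_smul, hω, mul_one, Real.norm_of_nonneg (H.r0_pos.trans ht).le]
  have hLe : ∀ t, ⟪c + t • ω - c, e⟫ = t * ⟪ω, e⟫ := fun t => by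
    rw [add_sub_cancel_left, real_inner_smul_left]
  have hL1 : ∀ t ∈ Ioc r0 T, ‖c + t • ω‖ ≤ r1 := fun t ht => by
    refine le_trans (le_of_sq_le_sq ?_ (norm_nonneg _)) hT1
    rw [H.norm_sq_eq (c + t • ω), H.norm_sq_eq (c + T • ω), ← hc, hLc t ht.1, hLc T hT0, hLe, hLe]
    have h1 := H.r0_pos
    have h2 := H.s_pos
    have h3 := ht.1
    have h4 : t * ⟪ω, e⟫ ≤ T * ⟪ω, e⟫ := mul_le_mul_of_nonneg_right ht.2 hωe.le
    nlinarith [ht.2]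
  have hcont : Continuous fun t : ℝ => c + t • ω := by fun_prop
  have hsymT : ∀ t ∈ Ioc r0 T, y (c + t • ω) = y (hyperplaneReflection e s (c + t • ω)) := by
    intro t ht
    rcases ht.2.lt_or_eq with h | rfl
    · exact (hsym t ⟨ht.1, h⟩).eq_of_nhds
    have hW : ∀ x : E, ‖x‖ ≤ r1 → r0 ≤ ‖x - c‖ → ContinuousAt y x := fun x h1 h2 =>
      (H.hasGradientAt h1 h2).hasFDerivAt.continuousAt
    have hse : s ≤ ⟪c + t • ω, e⟫ := by
      rw [inner_add_left, H.inner_center, real_inner_smul_left]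
      have := H.r0_pos.trans ht.1
      nlinarith
    have h1 : ContinuousAt (fun t : ℝ => y (c + t • ω)) t :=
      ContinuousAt.comp (f := fun t : ℝ => c + t • ω) (hW _ hT1 (by rw [hLc t ht.1]; exact ht.1.le))
        hcont.continuousAt
    have h2 : ContinuousAt (fun t : ℝ => y (hyperplaneReflection e s (c + t • ω))) t :=
      ContinuousAt.comp (f := fun t : ℝ => hyperplaneReflection e s (c + t • ω))
        (hW _ ((H.norm_reflection_le hse).trans hT1)
          (by rw [H.norm_reflection_sub_center, ← hc, hLc t ht.1]; exact ht.1.le))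
        ((continuous_hyperplaneReflection e s).comp hcont).continuousAt
    refine tendsto_nhds_unique_of_eventuallyEq
      (h1.tendsto.mono_left (nhdsWithin_le_nhds (s := Iio t)))
      (h2.tendsto.mono_left nhdsWithin_le_nhds) ?_
    filter_upwards [Ioo_mem_nhdsLT hT0] with τ hτ
    exact (hsym τ hτ).eq_of_nhds
  intro t ht x hx hxe
  refine H.eq_of_eq_reflection (hL1 t ht) (by rw [← hc, hLc t ht.1]; exact ht.1.le) (hsymT t ht)
    (by rw [← hc, hLc t ht.1]; exact hx) (by rw [← hc, hLe]; exact hxe)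

/-- A critical point of the profile along a ray near which `y` is symmetric is a critical point
of `y`. -/
lemma gradient_eq_zero_of_symm (H : IsAnnulusTorsion p r0 r1 s e y W) {ω : E} (hω : ‖ω‖ = 1)
    (hωe : 0 < ⟪ω, e⟫) {t : ℝ} (ht : r0 < t) (ht1 : ‖s • e + t • ω‖ < r1)
    (hsym : y =ᶠ[nhds (s • e + t • ω)] fun x => y (hyperplaneReflection e s x))
    (hd : ⟪gradient y (s • e + t • ω), ω⟫ = 0) : gradient y (s • e + t • ω) = 0 := by
  set c := s • e with hc
  have hr := H.r0_pos
  have hLc : ∀ t, r0 < t → ‖c + t • ω - c‖ = t := fun t ht => by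
    rw [add_sub_cancel_left, norm_smul, hω, mul_one, Real.norm_of_nonneg (hr.trans ht).le]
  set z := c + t • ω with hz
  have hzc : ‖z - c‖ = t := hLc t ht
  have hder : HasDerivAt (fun t : ℝ => y (c + t • ω)) 0 ‖z - c‖ := by
    rw [hzc, ← hd]
    exact H.hasDerivAt_line ht1.le (by rw [← hc, ← hz, hzc]; exact ht.le)
  have hnd : DifferentiableAt ℝ (fun x : E => ‖x - c‖) z :=
    (differentiableAt_id.sub_const c).norm ℝ (norm_pos_iff.1 (by rw [id, hzc]; linarith))
  have hcomp := HasDerivAt.comp_hasFDerivAt (h₂ := fun t : ℝ => y (c + t • ω))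
    (f := fun x : E => ‖x - c‖) z hder hnd.hasFDerivAt
  rw [zero_smul] at hcomp
  have hn : Continuous fun x : E => ‖x - c‖ := by fun_prop
  have hic : Continuous fun x : E => ⟪x - c, e⟫ := by fun_prop
  set Q : Set E := {x | (‖x‖ < r1 ∧ r0 < ‖x - c‖) ∧ 0 < ⟪x - c, e⟫ ∧
    y x = y (hyperplaneReflection e s x)} with hQ
  have hzQ : Q ∈ nhds z := by
    have h1 : {x : E | ‖x‖ < r1 ∧ r0 < ‖x - c‖} ∈ nhds z :=
      (isOpen_annulus r0 r1 c).mem_nhds ⟨ht1, by rw [hzc]; exact ht⟩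
    have h2 : {x : E | 0 < ⟪x - c, e⟫} ∈ nhds z :=
      (isOpen_lt continuous_const hic).mem_nhds (by
        simp only [mem_ofPred_eq]
        rw [hz, add_sub_cancel_left, real_inner_smul_left]
        exact mul_pos (by linarith) hωe)
    filter_upwards [h1, h2, hsym] with x hx1 hx2 hx3 using ⟨hx1, hx2, hx3⟩
  have hray : Continuous fun x : E => c + ‖x - c‖ • ω := by fun_prop
  have hzQ' : ∀ᶠ x in nhds z, c + ‖x - c‖ • ω ∈ Q :=
    hray.continuousAt.eventually_mem (by rw [hzc, ← hz]; exact hzQ)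
  have heq : y =ᶠ[nhds z] (fun t : ℝ => y (c + t • ω)) ∘ fun x : E => ‖x - c‖ := by
    filter_upwards [hzQ, hzQ'] with x hx hx'
    have hnx : ‖c + ‖x - c‖ • ω - c‖ = ‖x - c‖ := hLc _ hx.1.2
    simp only [Function.comp]
    rcases le_total ⟪x - c, e⟫ ⟪c + ‖x - c‖ • ω - c, e⟫ with h | h
    · exact H.eq_of_eq_reflection hx'.1.1.le hx'.1.2.le hx'.2.2 hnx.symm
        (by rw [← hc, abs_of_pos hx.2.1]; exact h)
    · exact (H.eq_of_eq_reflection hx.1.1.le hx.1.2.le hx.2.2 hnx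
        (by rw [← hc, abs_of_pos hx'.2.1]; exact h)).symm
  have hf := (hcomp.congr_of_eventuallyEq heq).fderiv
  rw [gradient, hf, map_zero]

/-- If the gradient is a constant multiple of the normal on a band of the inner sphere, then
along a ray starting in this band there is a first critical point, and `y` is constant on the
spherical zones up to it. -/
lemma exists_first_critical (H : IsAnnulusTorsion p r0 r1 s e y W) {a κ : ℝ} (ha : a ≠ 0)
    (hband : ∀ z, ‖z - s • e‖ = r0 → |⟪z - s • e, e⟫| < κ → gradient y z = a • (z - s • e))
    {ω : E} (hω : ‖ω‖ = 1) (hωe : 0 < ⟪ω, e⟫) (hωκ : r0 * ⟪ω, e⟫ < κ) :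
    ∃ T, r0 < T ∧ ‖s • e + T • ω‖ < r1 ∧ gradient y (s • e + T • ω) = 0 ∧
      ∀ t ∈ Ioc r0 T, ∀ x, ‖x - s • e‖ = t → |⟪x - s • e, e⟫| ≤ t * ⟪ω, e⟫ →
        y x = y (s • e + t • ω) := by
  set c := s • e with hc
  have hr := H.r0_pos
  have hs := H.s_pos
  set b := ⟪ω, e⟫ with hb
  have hLc : ∀ t, 0 < t → ‖c + t • ω - c‖ = t := fun t ht => by
    rw [add_sub_cancel_left, norm_smul, hω, mul_one, Real.norm_of_nonneg ht.le]
  have hLe : ∀ t, ⟪c + t • ω - c, e⟫ = t * b := fun t => by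
    rw [add_sub_cancel_left, real_inner_smul_left]
  have hLn : ∀ t, 0 < t → ‖c + t • ω‖ ^ 2 = t ^ 2 + 2 * s * (t * b) + s ^ 2 := fun t ht => by
    rw [H.norm_sq_eq, ← hc, hLc t ht, hLe]
  have hcont : Continuous fun t : ℝ => c + t • ω := by fun_prop
  have hr1 : 0 < r1 := by linarith [H.s_add_lt]
  obtain ⟨R, hRr, hR⟩ : ∃ R, r0 < R ∧ ‖c + R • ω‖ = r1 := by
    have h1 : ‖c + r0 • ω‖ < r1 := H.norm_lt_of_inner (hLc r0 hr)
    have h2 : r1 ≤ ‖c + r1 • ω‖ := by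
      refine le_of_sq_le_sq ?_ (norm_nonneg _)
      rw [hLn r1 hr1]
      have : 0 ≤ 2 * s * (r1 * b) := by positivity
      nlinarith [sq_nonneg s]
    obtain ⟨R, hR1, hR2⟩ := intermediate_value_Icc (by linarith [H.s_add_lt] : r0 ≤ r1)
      hcont.norm.continuousOn ⟨h1.le, h2⟩
    refine ⟨R, lt_of_le_of_ne hR1.1 ?_, hR2⟩
    rintro rfl
    exact h1.ne hR2
  have hLlt : ∀ t, r0 < t → t < R → ‖c + t • ω‖ < r1 := fun t h1 h2 => by
    rw [← hR]
    refine lt_of_pow_lt_pow_left₀ 2 (norm_nonneg _) ?_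
    rw [hLn t (by linarith), hLn R (by linarith)]
    have : t * b ≤ R * b := mul_le_mul_of_nonneg_right h2.le hωe.le
    nlinarith
  have hPO : ∀ t, r0 < t → t < R →
      c + t • ω ∈ {x : E | ‖x‖ < r1 ∧ r0 < ‖x - c‖} ∩ {x | s < ⟪x, e⟫} := fun t h1 h2 => by
    refine ⟨⟨hLlt t h1 h2, ?_⟩, ?_⟩
    · rw [hLc t (hr.trans h1)]; exact h1
    · simp only [mem_ofPred_eq]
      rw [inner_add_left, H.inner_center, real_inner_smul_left]
      have : 0 < t * b := mul_pos (hr.trans h1) hωe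
      linarith
  have hstart := H.eventually_eq_reflection_of_inner ha hband (z := c + r0 • ω) (hLc r0 hr)
    (by rw [← hc, hLe]; positivity) (by rw [← hc, hLe]; exact hωκ)
  have hsym : ∀ T, r0 < T → T ≤ R → (∀ t ∈ Ioo r0 T, gradient y (c + t • ω) ≠ 0) →
      ∀ t ∈ Ioo r0 T, y =ᶠ[nhds (c + t • ω)] fun x => y (hyperplaneReflection e s x) := by
    intro T hT hTR hne t ht
    refine H.eventuallyEq_reflection_of_isPreconnected (P := (fun t : ℝ => c + t • ω) '' Ioo r0 T)
      (isPreconnected_Ioo.image _ hcont.continuousOn) ?_ ?_ ?_ _ ⟨t, ht, rfl⟩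
    · rintro _ ⟨t, ht, rfl⟩
      exact hPO t ht.1 (ht.2.trans_le hTR)
    · rintro _ ⟨t, ht, rfl⟩
      exact hne t ht
    · have h1 := (hcont.continuousAt (x := r0)).eventually hstart.eventually_nhds
      have h2 : ∀ᶠ t in nhdsWithin r0 (Ioi r0), t ∈ Ioo r0 T := Ioo_mem_nhdsGT hT
      obtain ⟨τ, hτ1, hτ2⟩ := ((h1.filter_mono nhdsWithin_le_nhds).and h2).exists
      refine ⟨_, ⟨τ, hτ2, rfl⟩, ?_⟩
      filter_upwards [hτ1, (isOpen_annulus r0 r1 c).mem_nhds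
        (hPO τ hτ2.1 (hτ2.2.trans_le hTR)).1] with x hx hx'
      exact hx hx'.2
  have hder : ∀ t ∈ Icc r0 R, HasDerivAt (fun t : ℝ => y (c + t • ω))
      ⟪gradient y (c + t • ω), ω⟫ t := fun t ht => by
    have h0 : 0 < t := hr.trans_le ht.1
    refine H.hasDerivAt_line ?_ (by rw [← hc, hLc t h0]; exact ht.1)
    rcases ht.2.eq_or_lt with rfl | h
    · exact hR.le
    rcases ht.1.eq_or_lt with rfl | h'
    · exact (H.norm_lt_of_inner (hLc _ hr)).le
    · exact (hLlt t h' h).le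
  obtain ⟨t1, ht1, ht1g⟩ : ∃ t ∈ Ioo r0 R, gradient y (c + t • ω) = 0 := by
    by_contra! hcon
    obtain ⟨t, ht, ht'⟩ := exists_hasDerivAt_eq_zero hRr
      (fun t ht => (hder t ht).continuousAt.continuousWithinAt)
      (by rw [H.inner _ (hLc r0 hr), H.outer _ hR])
      (fun t ht => hder t ⟨ht.1.le, ht.2.le⟩)
    exact hcon t ht (H.gradient_eq_zero_of_symm hω hωe ht.1 (hLlt t ht.1 ht.2)
      (hsym R hRr le_rfl hcon t ht) ht')
  have hgc : ContinuousOn (fun t : ℝ => gradient y (c + t • ω)) (Icc r0 t1) :=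
    (continuousOn_gradient H.isOpen H.contDiffOn).comp hcont.continuousOn fun t ht => by
      have h0 : 0 < t := hr.trans_le ht.1
      refine H.mem _ ?_ (by rw [← hc, hLc t h0]; exact ht.1)
      rcases ht.1.eq_or_lt with rfl | h'
      · exact (H.norm_lt_of_inner (hLc _ hr)).le
      · exact (hLlt t h' (ht.2.trans_lt ht1.2)).le
  have hZ : IsCompact (Icc r0 t1 ∩ (fun t : ℝ => gradient y (c + t • ω)) ⁻¹' {0}) :=
    isCompact_Icc.of_isClosed_subset (hgc.preimage_isClosed_of_isClosed isClosed_Icc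
      isClosed_singleton) inter_subset_left
  obtain ⟨T, ⟨hT1, hT2⟩, hT3⟩ := hZ.exists_isLeast ⟨t1, ⟨ht1.1.le, le_rfl⟩, ht1g⟩
  have hT2 : gradient y (c + T • ω) = 0 := hT2
  have hTr : r0 < T := by
    refine lt_of_le_of_ne hT1.1 ?_
    rintro rfl
    rw [hband _ (hLc r0 hr) (by rw [hLe, abs_of_pos (by positivity)]; exact hωκ),
      add_sub_cancel_left, smul_smul, smul_eq_zero] at hT2
    rcases hT2 with h | h
    · exact mul_ne_zero ha hr.ne' h
    · simp [h] at hω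
  have hTR : T < R := hT1.2.trans_lt ht1.2
  refine ⟨T, hTr, hLlt T hTr hTR, hT2, H.eq_on_zone hω hωe hTr (hLlt T hTr hTR).le ?_⟩
  refine hsym T hTr hTR.le fun t ht h => ?_
  exact absurd (hT3 ⟨⟨ht.1.le, ht.2.le.trans hT1.2⟩, h⟩) (not_le.2 ht.2)

end IsAnnulusTorsion

end TorsionRay

section TorsionStrict

variable {E : Type*} [NormedAddCommGroup E] [InnerProductSpace ℝ E] [FiniteDimensional ℝ E]
  [MeasurableSpace E] [BorelSpace E]

namespace IsAnnulusTorsion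

variable {p r0 r1 s : ℝ} {e : E} {y : E → ℝ} {W : Set E}

/-- If `y` equals `M` on a zone around the equator of the sphere of radius `T` about the centre of
the hole, then `y ≥ M` outside this sphere near its equator. -/
lemma eventually_le_of_eq_on_zone (H : IsAnnulusTorsion p r0 r1 s e y W) {d : E} (hd : ‖d‖ = 1)
    (hde : ⟪d, e⟫ = 0) {T k M : ℝ} (hT : r0 < T) (hk : 0 < k)
    (hz : ∀ x, ‖x - s • e‖ = T → |⟪x - s • e, e⟫| ≤ k → ‖x‖ ≤ r1 ∧ y x = M) :
    ∀ᶠ x in nhds (s • e + T • d), T ≤ ‖x - s • e‖ → M ≤ y x := by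
  set c := s • e with hc
  set z := c + T • d with hzdef
  have hr := H.r0_pos
  have hs := H.s_pos
  have hT0 : 0 < T := hr.trans hT
  have hzc : z - c = T • d := add_sub_cancel_left _ _
  have hed : ⟪e, d⟫ = 0 := by rw [real_inner_comm]; exact hde
  have hee : ⟪e, e⟫ = 1 := by rw [real_inner_self_eq_norm_sq, H.norm_e]; norm_num
  have hdd : ⟪d, d⟫ = 1 := by rw [real_inner_self_eq_norm_sq, hd]; norm_num
  set n := √(4 * T ^ 2 + s ^ 2) with hn
  have hn0 : 0 < n := Real.sqrt_pos.2 (by positivity)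
  have hnsq : n ^ 2 = 4 * T ^ 2 + s ^ 2 := Real.sq_sqrt (by positivity)
  set u := (2 * T / n) • e - (s / n) • d with hu
  have hue : ⟪u, e⟫ = 2 * T / n := by
    rw [hu, inner_sub_left, real_inner_smul_left, real_inner_smul_left, hee, hde]; ring
  have hud : ⟪u, d⟫ = -(s / n) := by
    rw [hu, inner_sub_left, real_inner_smul_left, real_inner_smul_left, hed, hdd]; ring
  have huu : ‖u‖ = 1 := by
    have : ‖u‖ ^ 2 = 1 := by
      rw [← real_inner_self_eq_norm_sq]
      nth_rewrite 2 [hu]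
      rw [inner_sub_right, real_inner_smul_right, real_inner_smul_right, hue, hud]
      field_simp
      linarith
    exact (sq_eq_sq₀ (norm_nonneg _) zero_le_one).1 (by rw [this]; norm_num)
  set m := T * s / n with hm
  have hm0 : 0 < m := by positivity
  have hcu : ⟪c, u⟫ = 2 * m := by
    rw [hc, real_inner_smul_left, real_inner_comm, hue, hm]; ring
  have hzu : ⟪z, u⟫ = m := by
    rw [hzdef, inner_add_left, hcu, real_inner_smul_left, real_inner_comm, hud, hm]; ring
  have hueb : |⟪u, e⟫| ≤ 1 := by
    simpa [huu, H.norm_e] using abs_real_inner_le_norm u e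
  set t0 := min (min (m / 4) (k / 4)) (T * (s / n) / 2) with ht0
  have hs0 : 0 < T * (s / n) := by positivity
  have ht00 : 0 < t0 := lt_min (lt_min (by linarith) (by linarith)) (by linarith)
  have ht1 : t0 ≤ m / 4 := (min_le_left _ _).trans (min_le_left _ _)
  have ht2 : t0 ≤ k / 4 := (min_le_left _ _).trans (min_le_right _ _)
  have ht3 : t0 ≤ T * (s / n) / 2 := min_le_right _ _
  have hc1 : Continuous fun x : E => ‖x + (2 * t0) • u - c‖ := by fun_prop
  have hc2 : Continuous fun x : E => |⟪x - c, e⟫| := by fun_prop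
  have hc3 : Continuous fun x : E => |⟪x, u⟫ - m| := by fun_prop
  have he1 : ∀ᶠ x in nhds z, ‖x + (2 * t0) • u - c‖ < T := by
    refine hc1.continuousAt.eventually_lt continuousAt_const ?_
    refine lt_of_pow_lt_pow_left₀ 2 hT0.le ?_
    have h1 : z + (2 * t0) • u - c = T • d + (2 * t0) • u := by rw [hzdef]; abel
    rw [h1, norm_add_sq_real, norm_smul, norm_smul, real_inner_smul_left, real_inner_smul_right,
      real_inner_comm, hud, huu, hd, Real.norm_of_nonneg hT0.le,
      Real.norm_of_nonneg (by linarith)]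
    nlinarith
  have he2 : ∀ᶠ x in nhds z, |⟪x - c, e⟫| < k / 2 :=
    hc2.continuousAt.eventually_lt continuousAt_const (by
      rw [hzc, real_inner_smul_left, hde, mul_zero, abs_zero]; linarith)
  have he3 : ∀ᶠ x in nhds z, |⟪x, u⟫ - m| < m / 2 :=
    hc3.continuousAt.eventually_lt continuousAt_const (by rw [hzu, sub_self, abs_zero]; linarith)
  filter_upwards [he1, he2, he3] with x hx1 hx2 hx3 hxT
  have hcτ : Continuous fun τ : ℝ => ‖x + (2 * τ) • u - c‖ := by fun_prop
  obtain ⟨τ, hτ, hτT⟩ := intermediate_value_Icc' ht00.le hcτ.continuousOn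
    ⟨hx1.le, by simpa using hxT⟩
  have hτT : ‖x + (2 * τ) • u - c‖ = T := hτT
  have hXe : |⟪x + (2 * τ) • u - c, e⟫| ≤ k := by
    have h1 : x + (2 * τ) • u - c = (x - c) + (2 * τ) • u := by abel
    rw [h1, inner_add_left, real_inner_smul_left]
    refine (abs_add_le _ _).trans ?_
    rw [abs_mul, abs_of_nonneg (by linarith [hτ.1] : (0 : ℝ) ≤ 2 * τ)]
    nlinarith [hτ.1, hτ.2, abs_nonneg ⟪u, e⟫]
  obtain ⟨hX1, hXM⟩ := hz _ hτT hXe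
  have hXu : ⟪x + (2 * τ) • u, u⟫ = ⟪x, u⟫ + 2 * τ := by
    rw [inner_add_left, real_inner_smul_left, real_inner_self_eq_norm_sq, huu]; ring
  have hx3 := abs_lt.1 hx3
  have h := H.le_reflection huu (l := ⟪x, u⟫ + τ) (by linarith [hτ.1])
    (by rw [← hc, hcu]; linarith [hτ.2]) hX1 (by rw [← hc, hτT]; exact hT.le)
    (by rw [hXu]; linarith [hτ.1])
  rw [hXM] at h
  convert h using 2
  rw [hyperplaneReflection, hXu]
  module

/-- The gradient cannot be a constant multiple of the normal on a band of the inner sphere. -/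
lemma not_gradient_eq_smul_on_band (H : IsAnnulusTorsion p r0 r1 s e y W) {d : E} (hd : ‖d‖ = 1)
    (hde : ⟪d, e⟫ = 0) {a κ : ℝ} (ha : a ≠ 0) (hκ : 0 < κ) :
    ¬ ∀ z, ‖z - s • e‖ = r0 → |⟪z - s • e, e⟫| < κ → gradient y z = a • (z - s • e) := by
  intro hband
  set c := s • e with hc
  have hr := H.r0_pos
  have hs := H.s_pos
  have hed : ⟪e, d⟫ = 0 := by rw [real_inner_comm]; exact hde
  have hee : ⟪e, e⟫ = 1 := by rw [real_inner_self_eq_norm_sq, H.norm_e]; norm_num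
  set b := min (1 / 2) (κ / (2 * r0)) with hb
  have hb0 : 0 < b := lt_min (by norm_num) (by positivity)
  have hb1 : b ≤ 1 / 2 := min_le_left _ _
  have hbκ : r0 * b < κ := by
    have h1 : b ≤ κ / (2 * r0) := min_le_right _ _
    rw [le_div_iff₀ (by positivity)] at h1
    linarith
  set ω := b • e + √(1 - b ^ 2) • d with hω
  have hωe : ⟪ω, e⟫ = b := by
    rw [hω, inner_add_left, real_inner_smul_left, real_inner_smul_left, hee, hde]; ring
  have hω1 : ‖ω‖ = 1 := by
    have : ‖ω‖ ^ 2 = 1 := by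
      rw [hω, norm_add_sq_real, norm_smul, norm_smul, real_inner_smul_left, real_inner_smul_right,
        hed, hd, H.norm_e, Real.norm_of_nonneg hb0.le, Real.norm_of_nonneg (Real.sqrt_nonneg _),
        mul_one, mul_one, Real.sq_sqrt (by nlinarith)]
      ring
    exact (sq_eq_sq₀ (norm_nonneg _) zero_le_one).1 (by rw [this]; norm_num)
  obtain ⟨T, hT, hT1, hTg, hzone⟩ := H.exists_first_critical ha hband hω1
    (by rw [hωe]; exact hb0) (by rw [hωe]; exact hbκ)
  rw [hωe] at hzone
  have hT0 : 0 < T := hr.trans hT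
  have hLc : ∀ v : E, ‖v‖ = 1 → ∀ t, r0 < t → ‖c + t • v - c‖ = t := fun v hv t ht => by
    rw [add_sub_cancel_left, norm_smul, hv, mul_one, Real.norm_of_nonneg (hr.trans ht).le]
  have hLe : ∀ t, ⟪c + t • d - c, e⟫ = 0 := fun t => by
    rw [add_sub_cancel_left, real_inner_smul_left, hde, mul_zero]
  have hLω : ⟪c + T • ω - c, e⟫ = T * b := by
    rw [add_sub_cancel_left, real_inner_smul_left, hωe]
  have hnorm : ∀ x, ‖x - c‖ = T → |⟪x - c, e⟫| ≤ T * b → ‖x‖ < r1 := fun x hx hxe =>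
    (H.norm_le_of_norm_sub_eq (by rw [← hc, hLc ω hω1 T hT, hx])
      (by rw [← hc, hLω]; exact (abs_le.1 hxe).2)).trans_lt hT1
  set z := c + T • d with hz
  have hzT : ‖z - c‖ = T := hLc d hd T hT
  have hze : |⟪z - c, e⟫| ≤ T * b := by rw [hz, hLe, abs_zero]; positivity
  have hz1 : ‖z‖ < r1 := hnorm z hzT hze
  have hyz : y z = y (c + T • ω) := hzone T ⟨hT, le_rfl⟩ z hzT hze
  have hgz : ⟪gradient y z, d⟫ = 0 := by
    have h1 := H.hasDerivAt_line (c := c) (v := d) (t := T) hz1.le (by rw [hzT]; exact hT.le)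
    have h2 := H.hasDerivAt_line (c := c) (v := ω) (t := T) hT1.le
      (by rw [← hc, hLc ω hω1 T hT]; exact hT.le)
    have h3 : (fun t : ℝ => y (c + t • d)) =ᶠ[nhdsWithin T (Iic T)] fun t => y (c + t • ω) := by
      filter_upwards [Ioc_mem_nhdsLE hT] with t ht
      exact hzone t ht _ (hLc d hd t ht.1) (by
        rw [hLe, abs_zero]
        have := hr.trans ht.1
        positivity)
    have h4 := (h2.hasDerivWithinAt (s := Iic T)).congr_of_eventuallyEq h3 hyz
    have h5 := (uniqueDiffWithinAt_Iic T).eq_deriv _ h1.hasDerivWithinAt h4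
    rw [← hz] at h5
    rw [h5, hTg, inner_zero_left]
  have hev := H.eventually_le_of_eq_on_zone hd hde hT (mul_pos hT0 hb0) (M := y z)
    fun x hx hxe => ⟨(hnorm x hx hxe).le, by rw [hyz]; exact hzone T ⟨hT, le_rfl⟩ x hx hxe⟩
  have hev2 : ∀ᶠ x in nhds z, ‖x‖ < r1 :=
    continuous_norm.continuousAt.eventually_lt continuousAt_const hz1
  obtain ⟨ε, hε, hεb⟩ := Metric.eventually_nhds_iff_ball.1 (hev.and hev2)
  set R := ε / 4 with hR
  have hR0 : 0 < R := by positivity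
  set q := z + R • d with hq
  have hqz : q - z = R • d := add_sub_cancel_left _ _
  have hqzn : ‖q - z‖ = R := by rw [hqz, norm_smul, hd, mul_one, Real.norm_of_nonneg hR0.le]
  have hqc : ‖q - c‖ = T + R := by
    have : q - c = (T + R) • d := by rw [hq, hz]; module
    rw [this, norm_smul, hd, mul_one, Real.norm_of_nonneg (by positivity)]
  have hmem : ∀ w ∈ closedBall q R, w ∈ ball z ε ∧ T ≤ ‖w - c‖ := fun w hw => by
    rw [mem_closedBall_iff_norm] at hw
    constructor
    · rw [mem_ball_iff_norm]
      have := norm_add_le (w - q) (q - z)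
      rw [sub_add_sub_cancel, hqzn] at this
      linarith
    · have := norm_add_le (q - w) (w - c)
      rw [sub_add_sub_cancel, hqc, norm_sub_rev q w] at this
      linarith
  have hpos := H.hopf hR0
    (fun w hw => ⟨((hεb w (hmem w hw).1).2).le, hT.le.trans (hmem w hw).2⟩)
    (fun w hw => ⟨(hεb w (hmem w (ball_subset_closedBall hw)).1).2,
      hT.trans_le (hmem w (ball_subset_closedBall hw)).2⟩)
    (z := z) (by rw [mem_sphere_iff_norm, norm_sub_rev, hqzn])
    (fun w hw => (hεb w (hmem w (sphere_subset_closedBall hw)).1).1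
      (hmem w (sphere_subset_closedBall hw)).2)
  rw [hqz, real_inner_smul_right, hgz, mul_zero] at hpos
  exact lt_irrefl _ hpos

/-- Strict comparison of the normal derivatives at mirror points of the inner sphere. -/
lemma inner_gradient_lt_reflection (H : IsAnnulusTorsion p r0 r1 s e y W) {d : E} (hd : ‖d‖ = 1)
    (hde : ⟪d, e⟫ = 0) {x : E} (hx : ‖x - s • e‖ = r0) (hxe : s < ⟪x, e⟫) :
    ⟪gradient y x, x - s • e⟫ <
      ⟪gradient y (hyperplaneReflection e s x), hyperplaneReflection e s x - s • e⟫ := by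
  by_contra! hcon
  set x' := hyperplaneReflection e s x with hx'
  have hr := H.r0_pos
  have hx'c : ‖x' - s • e‖ = r0 := (H.norm_reflection_sub_center x).trans hx
  have hx'e : ⟪x', e⟫ = 2 * s - ⟪x, e⟫ := by
    rw [hx', hyperplaneReflection, inner_sub_left, real_inner_smul_left,
      real_inner_self_eq_norm_sq, H.norm_e]
    ring
  have hpos := H.inner_gradient_pos hx
  refine H.not_gradient_eq_smul_on_band hd hde (κ := ⟪x, e⟫ - s)
    (a := ⟪gradient y x, x - s • e⟫ / r0 ^ 2) (by positivity) (by linarith) fun z hz hze => ?_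
  rw [inner_sub_left, H.inner_center] at hze
  have h := abs_lt.1 hze
  have h1 := H.inner_gradient_le hx hz (by linarith)
  have h2 := H.inner_gradient_le hz hx'c (by linarith)
  rw [H.gradient_eq_smul hz, le_antisymm h1 (h2.trans hcon)]

end IsAnnulusTorsion

end TorsionStrict

section Coordinates

lemma IsWeakSolution.isWeakDiv {p : ℝ} (hp : 1 < p) {N : ℕ} {U : Set (EuclideanSpace ℝ (Fin N))}
    {u : EuclideanSpace ℝ (Fin N) → ℝ} (hU : IsOpen U) (hu : ContDiffOn ℝ 1 u U)
    (h : IsWeakSolution p U u fun _ => 1) :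
    IsWeakDiv U (fun x => fluxMap p (gradient u x)) 1 := by
  refine isWeakDiv_of_smooth hU
    ((continuous_fluxMap hp).comp_continuousOn (continuousOn_gradient hU hu)) fun φ h1 h2 h3 => ?_
  have h4 := h φ ⟨h1, h2, h3⟩
  rw [setIntegral_eq_integral_of_forall_compl_eq_zero,
    setIntegral_eq_integral_of_forall_compl_eq_zero] at h4
  · simpa only [Function.comp_apply, fluxMap, real_inner_smul_left, one_mul] using h4
  · intro x hx
    rw [one_mul]
    exact image_eq_zero_of_notMem_tsupport fun h => hx (h3 h)
  · intro x hx
    rw [gradient_eq_zero_of_notMem_tsupport fun h => hx (h3 h), inner_zero_right, mul_zero]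

variable {N : ℕ} (hN : 2 ≤ N)

lemma norm_e1v : ‖e1v hN‖ = 1 := by simp [e1v]

lemma inner_e1v (x : EuclideanSpace ℝ (Fin N)) : ⟪x, e1v hN⟫ = x (firstIdx N hN) := by
  simp [e1v, EuclideanSpace.inner_single_right]

lemma reflectH_eq (s : ℝ) (x : EuclideanSpace ℝ (Fin N)) :
    reflectH hN s x = hyperplaneReflection (e1v hN) s x := by
  rw [reflectH, hyperplaneReflection, inner_e1v]
  module

lemma annulus_eq {r0 : ℝ} (hr0 : 0 < r0) (r1 s : ℝ) :
    annulus hN r0 r1 s = {x | ‖x‖ < r1 ∧ r0 < ‖x - s • e1v hN‖} := by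
  ext x
  simp [annulus, closure_ball _ hr0.ne', dist_eq_norm]

lemma mem_closure_annulus {r0 r1 s : ℝ} (hr0 : 0 < r0) (hs : s ∈ Ioo 0 (r1 - r0))
    {x : EuclideanSpace ℝ (Fin N)} (h1 : ‖x‖ ≤ r1) (h2 : r0 ≤ ‖x - s • e1v hN‖) :
    x ∈ closure (annulus hN r0 r1 s) := by
  rw [annulus_eq hN hr0]
  set c := s • e1v hN with hc
  have hcn : ‖c‖ = s := by
    rw [hc, norm_smul, norm_e1v, mul_one, Real.norm_of_nonneg hs.1.le]
  have hle : ‖x‖ ≤ ‖x - c‖ + s := by simpa [hcn] using norm_add_le (x - c) c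
  have hlim : ∀ v : EuclideanSpace ℝ (Fin N),
      (∀ᶠ t in nhdsWithin (0 : ℝ) (Ioi 0),
        x + t • v ∈ {x | ‖x‖ < r1 ∧ r0 < ‖x - c‖}) →
      x ∈ closure {x | ‖x‖ < r1 ∧ r0 < ‖x - c‖} := fun v hv => by
    have hcont : Continuous fun t : ℝ => x + t • v := by fun_prop
    have := hcont.tendsto 0
    rw [zero_smul, add_zero] at this
    exact mem_closure_of_tendsto (this.mono_left nhdsWithin_le_nhds) hv
  rcases h2.eq_or_lt with h2 | h2
  · refine hlim (x - c) ?_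
    have hx : ‖x‖ < r1 := by linarith [hs.2]
    have hcont : Continuous fun t : ℝ => ‖x + t • (x - c)‖ := by fun_prop
    filter_upwards [self_mem_nhdsWithin, nhdsWithin_le_nhds
      (hcont.continuousAt.eventually_lt (x₀ := 0) continuousAt_const (by simpa using hx))]
      with t ht0 ht
    have ht0 : 0 < t := ht0
    refine ⟨ht, ?_⟩
    have : x + t • (x - c) - c = (1 + t) • (x - c) := by module
    rw [this, norm_smul, ← h2, Real.norm_of_nonneg (by linarith)]
    nlinarith
  · refine hlim (-x) ?_
    have hx0 : 0 < ‖x‖ ∨ ‖x‖ < r1 := by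
      rcases (norm_nonneg x).eq_or_lt with h | h
      · right; linarith [hs.1, hs.2]
      · exact Or.inl h
    have hcont : Continuous fun t : ℝ => ‖x + t • -x - c‖ := by fun_prop
    filter_upwards [Ioo_mem_nhdsGT (zero_lt_one' ℝ), nhdsWithin_le_nhds
      (continuousAt_const.eventually_lt (hcont.continuousAt (x := 0)) (by simpa using h2))]
      with t ht0 ht
    refine ⟨?_, ht⟩
    have : x + t • -x = (1 - t) • x := by module
    rw [this, norm_smul, Real.norm_of_nonneg (by linarith [ht0.2])]
    rcases hx0 with h | h <;> nlinarith [ht0.1, ht0.2, norm_nonneg x]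

lemma IsTorsionFn.exists_isAnnulusTorsion {p r0 r1 s : ℝ} (hp : 1 < p) (hr0 : 0 < r0)
    (hs : s ∈ Ioo 0 (r1 - r0)) {y : EuclideanSpace ℝ (Fin N) → ℝ}
    (hy : IsTorsionFn p (annulus hN r0 r1 s) y) :
    ∃ W, IsAnnulusTorsion p r0 r1 s (e1v hN) y W := by
  obtain ⟨⟨W, hWo, hWc, hyW⟩, hbd, hpos, hweak⟩ := hy
  have heq := annulus_eq hN hr0 r1 s
  have hopen : IsOpen (annulus hN r0 r1 s) := by
    rw [heq]; exact IsAnnulusTorsion.isOpen_annulus _ _ _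
  have hcn : ‖s • e1v hN‖ = s := by
    rw [norm_smul, norm_e1v, mul_one, Real.norm_of_nonneg hs.1.le]
  have hzero : ∀ x, ‖x‖ ≤ r1 → r0 ≤ ‖x - s • e1v hN‖ → x ∉ annulus hN r0 r1 s → y x = 0 :=
    fun x h1 h2 h3 => hbd x (by
      rw [hopen.frontier_eq]
      exact ⟨mem_closure_annulus hN hr0 hs h1 h2, h3⟩)
  refine ⟨W, hp, hr0, hs.1, by linarith [hs.2], norm_e1v hN, hWo,
    fun x h1 h2 => hWc (mem_closure_annulus hN hr0 hs h1 h2), hyW, fun x hx => ?_, fun x hx => ?_,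
    fun x h1 h2 => hpos x (by rw [heq]; exact ⟨h1, h2⟩), ?_⟩
  · refine hzero x hx.le ?_ (by rw [heq]; exact fun h => h.1.ne hx)
    have := norm_add_le (x - s • e1v hN) (s • e1v hN)
    rw [sub_add_cancel, hcn] at this
    linarith [hs.2]
  · refine hzero x ?_ hx.ge (by rw [heq]; exact fun h => h.2.ne' hx)
    have := norm_add_le (x - s • e1v hN) (s • e1v hN)
    rw [sub_add_cancel, hcn] at this
    linarith [hs.2]
  · rw [← heq]
    exact hweak.isWeakDiv hp hopen (hyW.mono (subset_closure.trans hWc))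

lemma exists_unit_inner_e1v_eq_zero :
    ∃ d : EuclideanSpace ℝ (Fin N), ‖d‖ = 1 ∧ ⟪d, e1v hN⟫ = 0 := by
  refine ⟨EuclideanSpace.single ⟨1, by omega⟩ 1, by simp, ?_⟩
  rw [inner_e1v]
  simp [firstIdx]

end Coordinates

/-- Strict boundary derivative inequality for the torsion function: for
`s ∈ (0, r1-r0)` and `x ∈ ∂B(s e₁, r0)` with `x₁ > s`,
`⟨∇y_s(x'), n(x')⟩ < ⟨∇y_s(x), n(x)⟩ < 0`, where `x'` is the reflection of `x` across
`{x₁ = s}` and `n(z) = (s e₁ - z)/r0`. -/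
theorem strict_boundary_inequality_torsion
    (N : ℕ) (hN : 2 ≤ N) (p : ℝ) (hp : 1 < p) (r0 r1 : ℝ)
    (hr0 : 0 < r0) (hr01 : r0 < r1)
    (s : ℝ) (hs : s ∈ Set.Ioo 0 (r1 - r0))
    (y : EuclideanSpace ℝ (Fin N) → ℝ)
    (hy : IsTorsionFn p (annulus hN r0 r1 s) y) :
    ∀ x ∈ Metric.sphere (s • e1v hN) r0, s < x (firstIdx N hN) →
      ⟪gradient y (reflectH hN s x), r0⁻¹ • (s • e1v hN - reflectH hN s x)⟫ <
        ⟪gradient y x, r0⁻¹ • (s • e1v hN - x)⟫ ∧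
      ⟪gradient y x, r0⁻¹ • (s • e1v hN - x)⟫ < 0 := by
  intro x hx hxs
  obtain ⟨W, H⟩ := hy.exists_isAnnulusTorsion hN hp hr0 hs
  obtain ⟨d, hd, hde⟩ := exists_unit_inner_e1v_eq_zero hN
  rw [mem_sphere_iff_norm] at hx
  have hneg : ∀ z g : EuclideanSpace ℝ (Fin N),
      ⟪g, r0⁻¹ • (s • e1v hN - z)⟫ = -(r0⁻¹ * ⟪g, z - s • e1v hN⟫) := fun z g => by
    rw [real_inner_smul_right, ← neg_sub z, inner_neg_right, mul_neg]
  have hri : 0 < r0⁻¹ := inv_pos.2 hr0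
  rw [hneg, hneg, reflectH_eq, neg_lt_neg_iff, neg_lt_zero]
  exact ⟨mul_lt_mul_of_pos_left
    (H.inner_gradient_lt_reflection hd hde hx (by rw [inner_e1v]; exact hxs)) hri,
    mul_pos hri (H.inner_gradient_pos hx)⟩

end
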